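/- Let p be a polynomial, let z₁,…,z_k ∈ 𝔻 be its zeros in the open unit disc with multiplicities n₁,…,n_k, set p_Λ(z) = ∏_{j=1}^k (z − z_j)^{n_j}, and let E = {ζ ∈ 𝕋 : p(ζ) = 0 and c_μ({ζ}) > 0}. Then [p]_{D(μ)} = {f ∈ D(μ) : f ∈ p_Λ H² and the radial limit of f exists and equals 0 at every point of E}. -/

import Mathlib

open MeasureTheory Metric Filter Complex Set
open scoped ENNReal Topology

noncomputable section

namespace DirichletMu

/-- The open unit disc in `ℂ`. -/
def disc : Set ℂ := Metric.ball 0 1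

/-- The unit circle `𝕋`. -/
def circleT : Set ℂ := Metric.sphere 0 1

/-- The boundary point `e^{it}`. -/
def bpt (t : ℝ) : ℂ := Complex.exp (Complex.I * (t : ℂ))

/-- Arc-length parametrizing measure on `(0, 2π]`. -/
def θm : Measure ℝ := volume.restrict (Set.Ioc 0 (2 * Real.pi))

/-- A measure is carried by the unit circle. -/
def OnCircle (μ : Measure ℂ) : Prop := μ circleTᶜ = 0

/-- The mean-square integrals of `f` over circles of radius `r < 1`. -/
def hardySet (f : ℂ → ℂ) : Set ℝ :=
  {x | ∃ r : ℝ, 0 < r ∧ r < 1 ∧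
    x = (1 / (2 * Real.pi)) * ∫ t in (0:ℝ)..(2 * Real.pi), ‖f ((r : ℂ) * bpt t)‖ ^ 2}

/-- Membership in the Hardy space `H²`. -/
def MemHardy2 (f : ℂ → ℂ) : Prop :=
  DifferentiableOn ℂ f disc ∧ BddAbove (hardySet f)

/-- The squared Hardy norm. -/
def hardyNormSq (f : ℂ → ℂ) : ℝ := sSup (hardySet f)

/-- Membership in `H^∞`. -/
def MemHinf (f : ℂ → ℂ) : Prop :=
  DifferentiableOn ℂ f disc ∧ ∃ C : ℝ, ∀ z ∈ disc, ‖f z‖ ≤ C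

/-- The sup norm over the disc. -/
def supNorm (f : ℂ → ℂ) : ℝ := sSup ((fun z => ‖f z‖) '' disc)

/-- The Poisson integral of the measure `μ`. -/
def poissonMu (μ : Measure ℂ) (z : ℂ) : ℝ :=
  ∫ ζ, (1 - ‖z‖ ^ 2) / ‖1 - (starRingEnd ℂ) ζ * z‖ ^ 2 ∂μ

/-- The integrand of the Dirichlet integral. -/
def dirichletDensity (μ : Measure ℂ) (f : ℂ → ℂ) (z : ℂ) : ℝ :=
  ‖deriv f z‖ ^ 2 * poissonMu μ z

/-- The Dirichlet integral `D_μ(f)`. -/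
def dirichletIntegral (μ : Measure ℂ) (f : ℂ → ℂ) : ℝ :=
  (1 / Real.pi) * ∫ z in disc, dirichletDensity μ f z

/-- Membership in the Dirichlet-type space `D(μ)`. -/
def MemD (μ : Measure ℂ) (f : ℂ → ℂ) : Prop :=
  MemHardy2 f ∧ IntegrableOn (dirichletDensity μ f) disc

/-- The squared norm `‖f‖_μ²` of `D(μ)`. -/
def dNormSq (μ : Measure ℂ) (f : ℂ → ℂ) : ℝ :=
  hardyNormSq f + dirichletIntegral μ f

/-- `f` has radial limit `L` at `ζ`. -/
def HasRadialLimitAt (f : ℂ → ℂ) (ζ L : ℂ) : Prop :=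
  Tendsto (fun r : ℝ => f ((r : ℂ) * ζ)) (nhdsWithin 1 (Set.Iio 1)) (nhds L)

/-- The modulus of `f` has radial limit `m` at `e^{it}`. -/
def BoundaryAbs (f : ℂ → ℂ) (t : ℝ) (m : ℝ) : Prop :=
  Tendsto (fun r : ℝ => ‖f ((r : ℂ) * bpt t)‖) (nhdsWithin 1 (Set.Iio 1)) (nhds m)

/-- The boundary zero set `Z_𝕋(f)`. -/
def ZT (f : ℂ → ℂ) : Set ℂ :=
  {ζ | ζ ∈ circleT ∧ HasRadialLimitAt f ζ 0}

/-- The set `Z̲(f)`. -/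
def Zlow (f : ℂ → ℂ) : Set ℂ :=
  {ζ | ζ ∈ Metric.closedBall (0 : ℂ) 1 ∧
    Filter.liminf (fun z => ‖f z‖) (nhdsWithin ζ disc) = 0}

def ZlowSet (S : Set (ℂ → ℂ)) : Set ℂ := ⋂ f ∈ S, Zlow f

def ZTSet (S : Set (ℂ → ℂ)) : Set ℂ := ⋂ f ∈ S, ZT f

/-- `[f]_{D(μ)}`: the closure in `D(μ)` of the polynomial multiples of `f`. -/
def closedSpan (μ : Measure ℂ) (f : ℂ → ℂ) : Set (ℂ → ℂ) :=
  {g | MemD μ g ∧ ∀ ε > 0, ∃ q : Polynomial ℂ,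
    dNormSq μ (fun z => g z - q.eval z * f z) < ε}

/-- `f` is cyclic for `D(μ)`. -/
def IsCyclic (μ : Measure ℂ) (f : ℂ → ℂ) : Prop :=
  closedSpan μ f = {g | MemD μ g}

/-- `f` is the outer function with boundary modulus `φ` (parametrized by `e^{it}`). -/
def OuterWith (f : ℂ → ℂ) (φ : ℝ → ℝ) : Prop :=
  (∀ t, 0 ≤ φ t) ∧
  IntervalIntegrable (fun t => Real.log (φ t)) volume 0 (2 * Real.pi) ∧
  ∀ z ∈ disc, f z = Complex.exp (((2 * Real.pi : ℝ) : ℂ)⁻¹ *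
    ∫ t in (0:ℝ)..(2 * Real.pi), ((bpt t + z) / (bpt t - z)) * (Real.log (φ t) : ℂ))

/-- `f` is an outer function. -/
def IsOuter (f : ℂ → ℂ) : Prop := ∃ φ, OuterWith f φ

/-- Inner functions. -/
def IsInner (f : ℂ → ℂ) : Prop :=
  DifferentiableOn ℂ f disc ∧ (∀ z ∈ disc, ‖f z‖ ≤ 1) ∧
  ∀ᵐ t ∂θm, BoundaryAbs f t 1

/-- `f / Θ ∈ H²`. -/
def InnerDivides (Θ f : ℂ → ℂ) : Prop :=
  ∃ g, MemHardy2 g ∧ ∀ z ∈ disc, f z = Θ z * g z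

/-- `Θ / Θ'` is bounded on the disc. -/
def DividesBdd (Θ' Θ : ℂ → ℂ) : Prop :=
  ∃ g, MemHinf g ∧ ∀ z ∈ disc, Θ z = Θ' z * g z

/-- `Θ` is the greatest common inner divisor of the family `M`. -/
def IsGCDInner (M : Set (ℂ → ℂ)) (Θ : ℂ → ℂ) : Prop :=
  IsInner Θ ∧ (∀ f ∈ M, InnerDivides Θ f) ∧
  ∀ Θ', IsInner Θ' → (∀ f ∈ M, InnerDivides Θ' f) → DividesBdd Θ' Θ

/-- The set `Θ H²`. -/
def innerMulH2 (Θ : ℂ → ℂ) : Set (ℂ → ℂ) :=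
  {h | ∃ g, MemHardy2 g ∧ ∀ z ∈ disc, h z = Θ z * g z}

/-- Poisson extension of a boundary function (parametrized by `e^{it}`). -/
def poissonExt (u : ℝ → ℝ) (z : ℂ) : ℝ :=
  (1 / (2 * Real.pi)) * ∫ t in (0:ℝ)..(2 * Real.pi),
    ((1 - ‖z‖ ^ 2) / ‖bpt t - z‖ ^ 2) * u t

/-- `|∇ P[u]|² P_μ`. -/
def gradDensity (μ : Measure ℂ) (u : ℝ → ℝ) (z : ℂ) : ℝ :=
  ‖fderiv ℝ (poissonExt u) z‖ ^ 2 * poissonMu μ z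

/-- Membership in the harmonic Dirichlet space `D^h(μ)`. -/
def MemDh (μ : Measure ℂ) (u : ℝ → ℝ) : Prop :=
  IntegrableOn (fun t => (u t) ^ 2) (Set.Ioc 0 (2 * Real.pi)) volume ∧
  IntegrableOn (gradDensity μ u) disc

/-- The squared norm of `D^h(μ)`. -/
def dhNormSq (μ : Measure ℂ) (u : ℝ → ℝ) : ℝ :=
  (1 / (2 * Real.pi)) * (∫ t in Set.Ioc 0 (2 * Real.pi), (u t) ^ 2) +
  (1 / Real.pi) * ∫ z in disc, gradDensity μ u z

/-- Relatively open subsets of the circle. -/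
def RelOpen (U : Set ℂ) : Prop := ∃ V : Set ℂ, IsOpen V ∧ U = V ∩ circleT

/-- Capacity of a relatively open subset of the circle. -/
def capOpen (μ : Measure ℂ) (U : Set ℂ) : ℝ≥0∞ :=
  ⨅ (u : ℝ → ℝ) (_ : MemDh μ u ∧ (∀ t, 0 ≤ u t) ∧
      ∀ᵐ t ∂θm, bpt t ∈ U → 1 ≤ u t),
    ENNReal.ofReal (dhNormSq μ u)

/-- The capacity `c_μ` of an arbitrary subset of the circle. -/
def cap (μ : Measure ℂ) (F : Set ℂ) : ℝ≥0∞ :=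
  ⨅ (U : Set ℂ) (_ : RelOpen U ∧ F ⊆ U), capOpen μ U

/-- The (closed) support of a measure on `ℂ`. -/
def msupport (μ : Measure ℂ) : Set ℂ :=
  {x | ∀ r > 0, 0 < μ (Metric.ball x r)}

/-- `M_μ(E)`: functions of `D(μ)` whose radial limits vanish `c_μ`-q.e. on `E`. -/
def Mspace (μ : Measure ℂ) (E : Set ℂ) : Set (ℂ → ℂ) :=
  {g | MemD μ g ∧ ∃ N : Set ℂ, cap μ N = 0 ∧ ∀ ζ ∈ E \ N, HasRadialLimitAt g ζ 0}

/-- Closed shift-invariant subspaces of `D(μ)` (closedness for the `D(μ)` norm). -/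
structure ClosedInvSubspace (μ : Measure ℂ) (M : Set (ℂ → ℂ)) : Prop where
  subset : M ⊆ {f | MemD μ f}
  zero_mem : (fun _ => (0 : ℂ)) ∈ M
  add_mem : ∀ f ∈ M, ∀ g ∈ M, (fun z => f z + g z) ∈ M
  smul_mem : ∀ (c : ℂ), ∀ f ∈ M, (fun z => c * f z) ∈ M
  shift_mem : ∀ f ∈ M, (fun z => z * f z) ∈ M
  closed : ∀ g, MemD μ g →
    (∀ ε > 0, ∃ h ∈ M, dNormSq μ (fun z => g z - h z) < ε) → g ∈ M

/-- The norm `‖f‖_{∞,μ}` of the Banach algebra `D(μ) ∩ H^∞`. -/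
def algNorm (μ : Measure ℂ) (f : ℂ → ℂ) : ℝ :=
  supNorm f + Real.sqrt (dirichletIntegral μ f)

/-- Membership in the Banach algebra `D(μ) ∩ H^∞`. -/
def MemA (μ : Measure ℂ) (f : ℂ → ℂ) : Prop := MemD μ f ∧ MemHinf f

/-- Closed ideals of `D(μ) ∩ H^∞`. -/
structure ClosedIdeal (μ : Measure ℂ) (J : Set (ℂ → ℂ)) : Prop where
  subset : J ⊆ {f | MemA μ f}
  zero_mem : (fun _ => (0 : ℂ)) ∈ J
  add_mem : ∀ f ∈ J, ∀ g ∈ J, (fun z => f z + g z) ∈ J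
  mul_mem : ∀ f, MemA μ f → ∀ g ∈ J, (fun z => f z * g z) ∈ J
  closed : ∀ g, MemA μ g →
    (∀ ε > 0, ∃ h ∈ J, algNorm μ (fun z => g z - h z) < ε) → g ∈ J

/-- A multiplier of `D(μ)`. -/
def IsMultiplier (μ : Measure ℂ) (φ : ℂ → ℂ) : Prop :=
  DifferentiableOn ℂ φ disc ∧ ∀ g, MemD μ g → MemD μ (fun z => φ z * g z)

/-- Distance between two subsets of `ℂ`. -/
def setDist (A B : Set ℂ) : ℝ :=
  sInf ((fun p : ℂ × ℂ => dist p.1 p.2) '' (A ×ˢ B))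

open scoped Classical in
/-- The polynomial `p_Λ` built from the zeros of `p` lying in the open unit disc
(with multiplicities). -/
def discPart (p : Polynomial ℂ) : Polynomial ℂ :=
  ((p.roots.filter (fun w => w ∈ disc)).map
    (fun w => Polynomial.X - Polynomial.C w)).prod

/-- The squared `ℓ²` norm of a sequence. -/
def l2 (x : ℕ → ℂ) : ℝ≥0∞ := ∑' n, ENNReal.ofReal (‖x n‖ ^ 2)

/-- The Dirichlet energy of a sequence of weighted Taylor coefficients. -/
def seqEnergy (α : ℕ → ℂ) : ℝ≥0∞ :=
  ∑' n : ℕ, ENNReal.ofReal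
    (‖∑ j ∈ Finset.range (n + 1), ((j : ℂ) + 1) * α j‖ ^ 2 / ((n + 1) * (n + 2)))

lemma norm_add_sq_le (a b : ℂ) : ‖a + b‖ ^ 2 ≤ 2 * ‖a‖ ^ 2 + 2 * ‖b‖ ^ 2 := by
  have := norm_add_le a b
  nlinarith [sq_nonneg (‖a‖ - ‖b‖), norm_nonneg (a + b), norm_nonneg a, norm_nonneg b]

lemma ofReal_norm_add_sq_le (a b : ℂ) : ENNReal.ofReal (‖a + b‖ ^ 2) ≤
    2 * ENNReal.ofReal (‖a‖ ^ 2) + 2 * ENNReal.ofReal (‖b‖ ^ 2) := by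
  rw [show (2 : ℝ≥0∞) = ENNReal.ofReal 2 by simp, ← ENNReal.ofReal_mul (by norm_num),
    ← ENNReal.ofReal_mul (by norm_num), ← ENNReal.ofReal_add (by positivity) (by positivity)]
  exact ENNReal.ofReal_le_ofReal (norm_add_sq_le a b)

lemma l2_add_le (x y : ℕ → ℂ) : l2 (fun n => x n + y n) ≤ 2 * l2 x + 2 * l2 y := by
  unfold l2
  rw [← ENNReal.tsum_mul_left, ← ENNReal.tsum_mul_left, ← ENNReal.tsum_add]
  exact ENNReal.tsum_le_tsum fun n => ofReal_norm_add_sq_le _ _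

lemma l2_const_mul (c : ℂ) (x : ℕ → ℂ) :
    l2 (fun n => c * x n) = ENNReal.ofReal (‖c‖ ^ 2) * l2 x := by
  unfold l2
  rw [← ENNReal.tsum_mul_left]
  congr 1; ext n
  rw [norm_mul, mul_pow, ENNReal.ofReal_mul (by positivity)]

lemma seqEnergy_eq_l2 (α : ℕ → ℂ) : seqEnergy α = l2 (fun n : ℕ =>
    ((Real.sqrt ((n + 1) * (n + 2)))⁻¹ : ℝ) *
      ∑ j ∈ Finset.range (n + 1), ((j : ℂ) + 1) * α j) := by
  unfold seqEnergy l2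
  congr 1; ext n
  congr 1
  rw [norm_mul, mul_pow, Complex.norm_real, Real.norm_eq_abs, sq_abs, inv_pow,
    Real.sq_sqrt (by positivity), div_eq_inv_mul]

lemma seqEnergy_add_le (x y : ℕ → ℂ) :
    seqEnergy (fun n => x n + y n) ≤ 2 * seqEnergy x + 2 * seqEnergy y := by
  simp only [seqEnergy_eq_l2]
  refine le_trans (le_of_eq ?_) (l2_add_le _ _)
  congr 1; ext n
  simp only [mul_add, Finset.sum_add_distrib]

lemma seqEnergy_const_mul (c : ℂ) (x : ℕ → ℂ) :
    seqEnergy (fun n => c * x n) = ENNReal.ofReal (‖c‖ ^ 2) * seqEnergy x := by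
  simp only [seqEnergy_eq_l2, ← l2_const_mul]
  congr 1; ext n
  simp only [Finset.mul_sum]
  exact Finset.sum_congr rfl fun j _ => by ring

/-- Weighted Cauchy–Schwarz inequality for series. -/
lemma weighted_cauchy_schwarz {w : ℕ → ℝ} {v x : ℕ → ℂ} (hw : ∀ j, 0 ≤ w j) (hws : Summable w)
    (hx : Summable fun j => w j * ‖x j‖ ^ 2) (hv : ∀ j, ‖v j‖ ≤ w j * ‖x j‖) :
    Summable v ∧ ‖∑' j, v j‖ ^ 2 ≤ (∑' j, w j) * ∑' j, w j * ‖x j‖ ^ 2 := by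
  have hs : Summable v := by
    refine Summable.of_norm_bounded (hws.add hx) fun j => (hv j).trans ?_
    nlinarith [hw j, mul_nonneg (hw j) (sq_nonneg (‖x j‖ - 1)), norm_nonneg (x j),
      mul_nonneg (hw j) (norm_nonneg (x j))]
  refine ⟨hs, ?_⟩
  refine le_of_tendsto (hs.hasSum.tendsto_sum_nat.norm.pow 2) (Eventually.of_forall fun N => ?_)
  have h1 : ‖∑ j ∈ Finset.range N, v j‖ ≤ ∑ j ∈ Finset.range N, w j * ‖x j‖ :=
    (norm_sum_le _ _).trans (Finset.sum_le_sum fun j _ => hv j)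
  have h2 : (∑ j ∈ Finset.range N, w j * ‖x j‖) ^ 2 ≤
      (∑ j ∈ Finset.range N, w j) * ∑ j ∈ Finset.range N, w j * ‖x j‖ ^ 2 :=
    Finset.sum_sq_le_sum_mul_sum_of_sq_le_mul _ (fun j _ => hw j)
      (fun j _ => mul_nonneg (hw j) (sq_nonneg _)) (fun j _ => le_of_eq (by ring))
  calc ‖∑ j ∈ Finset.range N, v j‖ ^ 2 ≤ (∑ j ∈ Finset.range N, w j * ‖x j‖) ^ 2 := by gcongr
    _ ≤ _ := h2
    _ ≤ _ := by
      gcongr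
      · exact Finset.sum_nonneg fun j _ => mul_nonneg (hw j) (sq_nonneg _)
      · exact tsum_nonneg hw
      · exact hws.sum_le_tsum _ fun j _ => hw j
      · exact hx.sum_le_tsum _ fun j _ => mul_nonneg (hw j) (sq_nonneg _)

lemma sum_mul_sub (β : ℕ → ℂ) (n : ℕ) :
    ∑ j ∈ Finset.range (n + 1), ((j : ℂ) + 1) * (β j - β (j + 1)) =
      ∑ j ∈ Finset.range (n + 1), β j - (n + 1) * β (n + 1) := by
  induction n with
  | zero => simp
  | succ n ih =>
    rw [Finset.sum_range_succ, ih, Finset.sum_range_succ _ (n + 1)]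
    push_cast; ring

lemma variance_update (S b : ℂ) {m : ℝ} (hm : 0 < m) :
    ‖S - m * b‖ ^ 2 / (m * (m + 1)) = ‖S‖ ^ 2 / m + ‖b‖ ^ 2 - ‖S + b‖ ^ 2 / (m + 1) := by
  have h : ∀ z : ℂ, ‖z‖ ^ 2 = z.re ^ 2 + z.im ^ 2 := fun z => by
    rw [← Complex.normSq_eq_norm_sq, Complex.normSq_apply]; ring
  simp only [h, Complex.sub_re, Complex.sub_im, Complex.add_re, Complex.add_im,
    Complex.mul_re, Complex.mul_im, Complex.ofReal_re, Complex.ofReal_im]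
  field_simp
  ring

lemma energy_partial_sum (β : ℕ → ℂ) (N : ℕ) :
    ∑ n ∈ Finset.range N, ‖∑ j ∈ Finset.range (n + 1), ((j : ℂ) + 1) * (β j - β (j + 1))‖ ^ 2 /
        (((n : ℝ) + 1) * (n + 2)) =
      ∑ n ∈ Finset.range (N + 1), ‖β n‖ ^ 2 -
        ‖∑ j ∈ Finset.range (N + 1), β j‖ ^ 2 / ((N : ℝ) + 1) := by
  induction N with
  | zero => simp
  | succ N ih =>
    rw [Finset.sum_range_succ, ih, sum_mul_sub, Finset.sum_range_succ _ (N + 1),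
      Finset.sum_range_succ _ (N + 1)]
    have h := variance_update (∑ j ∈ Finset.range (N + 1), β j) (β (N + 1))
      (m := (N : ℝ) + 1) (by positivity)
    push_cast at h ⊢
    rw [show (N : ℝ) + 1 + 1 = N + 2 by ring] at h ⊢
    rw [h]; ring

lemma seqEnergy_diff_le (β : ℕ → ℂ) : seqEnergy (fun n => β n - β (n + 1)) ≤ l2 β := by
  refine ENNReal.tsum_le_of_sum_range_le fun N => ?_
  rw [← ENNReal.ofReal_sum_of_nonneg fun n _ => by positivity, energy_partial_sum]
  calc _ ≤ ENNReal.ofReal (∑ n ∈ Finset.range (N + 1), ‖β n‖ ^ 2) :=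
        ENNReal.ofReal_le_ofReal (sub_le_self _ (by positivity))
    _ = ∑ n ∈ Finset.range (N + 1), ENNReal.ofReal (‖β n‖ ^ 2) :=
        ENNReal.ofReal_sum_of_nonneg fun n _ => by positivity
    _ ≤ _ := ENNReal.sum_le_tsum _

lemma hasSum_inv_mul_succ (m : ℕ) :
    HasSum (fun j : ℕ => 1 / (((m + j : ℕ) : ℝ) + 1) / (((m + j : ℕ) : ℝ) + 2))
      (1 / ((m : ℝ) + 1)) := by
  rw [hasSum_iff_tendsto_nat_of_nonneg fun j => by positivity]
  have h : ∀ N : ℕ, ∑ j ∈ Finset.range N,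
      1 / (((m + j : ℕ) : ℝ) + 1) / (((m + j : ℕ) : ℝ) + 2) =
      1 / ((m : ℝ) + 1) - 1 / ((N : ℝ) + (m + 1)) := by
    intro N
    induction N with
    | zero => simp
    | succ N ih =>
      rw [Finset.sum_range_succ, ih]
      push_cast
      field_simp
      ring
  simp only [h]
  have h2 : Tendsto (fun N : ℕ => 1 / ((N : ℝ) + (m + 1))) atTop (𝓝 0) := by
    simp only [one_div]
    exact tendsto_inv_atTop_zero.comp
      (tendsto_atTop_add_const_right _ _ tendsto_natCast_atTop_atTop)
  simpa using tendsto_const_nhds.sub h2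

lemma summable_of_l2_ne_top {x : ℕ → ℂ} (h : l2 x ≠ ⊤) : Summable fun n => ‖x n‖ ^ 2 := by
  have := ENNReal.summable_toReal h
  simpa [ENNReal.toReal_ofReal, sq_nonneg] using this

lemma exists_diff_of_seqEnergy_ne_top {α : ℕ → ℂ} (h : seqEnergy α ≠ ⊤) :
    ∃ β : ℕ → ℂ, (∀ n, α n = β n - β (n + 1)) ∧ l2 β ≤ seqEnergy α := by
  set t : ℕ → ℂ := fun n => ∑ j ∈ Finset.range (n + 1), ((j : ℂ) + 1) * α j with ht
  set w : ℕ → ℝ := fun k => 1 / ((k : ℝ) + 1) / ((k : ℝ) + 2) with hw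
  have hw0 : ∀ k, 0 ≤ w k := fun k => by positivity
  set τ : ℕ → ℝ := fun n => ‖t n‖ ^ 2 / (((n : ℝ) + 1) * (n + 2)) with hτ
  have hτw : ∀ n, τ n = w n * ‖t n‖ ^ 2 := fun n => by simp only [hτ, hw]; field_simp
  have hτ0 : ∀ n, 0 ≤ τ n := fun n => by positivity
  have hτs : Summable τ := by
    have := ENNReal.summable_toReal h
    refine this.congr fun n => ?_
    rw [ENNReal.toReal_ofReal (hτ0 n)]
  have hE : seqEnergy α = ENNReal.ofReal (∑' n, τ n) :=
    (ENNReal.ofReal_tsum_of_nonneg hτ0 hτs).symm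
  have hcs : ∀ m : ℕ, Summable (fun j => (w (m + j) : ℂ) * t (m + j)) ∧
      ‖∑' j, (w (m + j) : ℂ) * t (m + j)‖ ^ 2 ≤ (1 / ((m : ℝ) + 1)) * ∑' j, τ (m + j) := by
    intro m
    have hws := hasSum_inv_mul_succ m
    have := weighted_cauchy_schwarz (w := fun j => w (m + j))
      (v := fun j => (w (m + j) : ℂ) * t (m + j)) (x := fun j => t (m + j))
      (fun j => hw0 _) hws.summable
      (by
        simp only [← hτw]
        simpa only [add_comm] using (summable_nat_add_iff m).2 hτs)
      (fun j => by rw [norm_mul, Complex.norm_real, Real.norm_of_nonneg (hw0 _)])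
    refine ⟨this.1, this.2.trans (le_of_eq ?_)⟩
    simp only [← hτw]
    congr 1
    exact hws.tsum_eq
  set A : ℕ → ℂ := fun m => ∑' j, (w (m + j) : ℂ) * t (m + j) with hA
  have hAs : ∀ m, A m = (w m : ℂ) * t m + A (m + 1) := by
    intro m
    simp only [hA]
    rw [(hcs m).1.tsum_eq_zero_add]
    simp only [add_zero]
    congr 2; ext j
    rw [show m + (j + 1) = m + 1 + j by ring]
  set β : ℕ → ℂ := fun n => A 0 - ∑ j ∈ Finset.range n, α j with hβ
  have hd : ∀ n, α n = β n - β (n + 1) := fun n => by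
    simp only [hβ, Finset.sum_range_succ]; ring
  have hS : ∀ n : ℕ, ∑ j ∈ Finset.range (n + 1), β j = (n + 1) * A n := by
    intro n
    induction n with
    | zero => simp [hβ]
    | succ n ih =>
      have h1 := sum_mul_sub β n
      simp only [← hd] at h1
      have h2 : t n = ((n : ℂ) + 1) * A n - (n + 1) * β (n + 1) := by rw [← ih]; exact h1
      have hn1 : (n : ℂ) + 1 ≠ 0 := Nat.cast_add_one_ne_zero n
      have hn2 : (n : ℂ) + 2 ≠ 0 := by exact_mod_cast (by omega : n + 2 ≠ 0)
      have h3 := hAs n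
      simp only [hw] at h3
      push_cast at h3
      rw [Finset.sum_range_succ, ih]
      have h4 : A (n + 1) = A n - 1 / ((n : ℂ) + 1) / (n + 2) * t n := by rw [h3]; ring
      rw [h4, h2]
      push_cast
      field_simp
      ring
  refine ⟨β, hd, ?_⟩
  rw [hE]
  refine ENNReal.tsum_le_of_sum_range_le fun N => ?_
  rw [← ENNReal.ofReal_sum_of_nonneg fun n _ => by positivity]
  refine ENNReal.ofReal_le_ofReal ?_
  have h1 := energy_partial_sum β N
  simp only [← hd] at h1
  have h2 : ∑ n ∈ Finset.range N, τ n = ∑ n ∈ Finset.range (N + 1), ‖β n‖ ^ 2 -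
      ((N : ℝ) + 1) * ‖A N‖ ^ 2 := by
    rw [show ∑ n ∈ Finset.range N, τ n = _ from h1, hS, norm_mul, mul_pow]
    congr 1
    rw [show ‖(N : ℂ) + 1‖ = (N : ℝ) + 1 by
      rw [← Nat.cast_add_one, Complex.norm_natCast]; push_cast; ring]
    field_simp
  have h3 : ((N : ℝ) + 1) * ‖A N‖ ^ 2 ≤ ∑' j, τ (N + j) := by
    have := (hcs N).2
    calc ((N : ℝ) + 1) * ‖A N‖ ^ 2 ≤ (N + 1) * (1 / ((N : ℝ) + 1) * ∑' j, τ (N + j)) := by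
          gcongr
      _ = _ := by field_simp
  have h4 := hτs.sum_add_tsum_nat_add N
  have h5 : ∑ n ∈ Finset.range N, ‖β n‖ ^ 2 ≤ ∑ n ∈ Finset.range (N + 1), ‖β n‖ ^ 2 :=
    Finset.sum_le_sum_of_subset_of_nonneg (Finset.range_mono (Nat.le_succ N))
      fun _ _ _ => by positivity
  simp only [add_comm _ N] at h4
  linarith

lemma tsum_tsum_add (f : ℕ → ℝ≥0∞) :
    ∑' n, ∑' j, f (n + j) = ∑' k : ℕ, ((k : ℝ≥0∞) + 1) * f k := by
  rw [← ENNReal.tsum_prod (f := fun n j => f (n + j)),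
    ← Finset.HasAntidiagonal.sigmaAntidiagonalEquivProd.tsum_eq, ENNReal.tsum_sigma']
  congr 1; ext k
  rw [tsum_fintype]
  have : ∀ b : ↥(Finset.HasAntidiagonal.antidiagonal k),
      f ((Finset.HasAntidiagonal.sigmaAntidiagonalEquivProd ⟨k, b⟩).1 +
      (Finset.HasAntidiagonal.sigmaAntidiagonalEquivProd ⟨k, b⟩).2) = f k := by
    rintro ⟨b, hb⟩
    simp [Finset.HasAntidiagonal.sigmaAntidiagonalEquivProd,
      Finset.HasAntidiagonal.mem_antidiagonal.1 hb]
  simp only [this, Finset.sum_const, nsmul_eq_mul]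
  simp

lemma seqEnergy_mul_le {β : ℕ → ℂ} (hβ : l2 β ≠ ⊤) {ρ : ℕ → ℝ} (h0 : ∀ n, 0 ≤ ρ n)
    (h1 : ∀ n, ρ n ≤ 1) (hmono : Monotone ρ)
    (hconc : ∀ n : ℕ, ((n : ℝ) + 1) * (ρ (n + 1) - ρ n) ≤ ρ (n + 1)) :
    seqEnergy (fun n => ρ n * (β n - β (n + 1))) ≤
      ∑' n, ENNReal.ofReal (4 * ρ n * ‖β n‖ ^ 2) := by
  set δ : ℕ → ℝ := fun j => ρ (j + 1) - ρ j with hδ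
  have hδ0 : ∀ j, 0 ≤ δ j := fun j => sub_nonneg.2 (hmono (Nat.le_succ j))
  have hβs := summable_of_l2_ne_top hβ
  have hδ1 : ∀ n, Summable (fun j => δ (n + j)) ∧ ∑' j, δ (n + j) ≤ 1 := by
    intro n
    have hb : ∀ N, ∑ j ∈ Finset.range N, δ (n + j) ≤ 1 := fun N => by
      have : ∑ j ∈ Finset.range N, δ (n + j) = ρ (n + N) - ρ n :=
        Finset.sum_range_sub (fun j => ρ (n + j)) N
      rw [this]; linarith [h1 (n + N), h0 n]
    exact ⟨summable_of_sum_range_le (fun j => hδ0 _) hb,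
      Real.tsum_le_of_sum_range_le (fun j => hδ0 _) hb⟩
  have hδle : ∀ j, δ j ≤ 1 := fun j => by simp only [hδ]; linarith [h1 (j + 1), h0 j]
  have hδβ : Summable (fun j => δ j * ‖β (j + 1)‖ ^ 2) :=
    Summable.of_nonneg_of_le (fun j => mul_nonneg (hδ0 j) (sq_nonneg _))
      (fun j => mul_le_of_le_one_left (sq_nonneg _) (hδle j)) ((summable_nat_add_iff 1).2 hβs)
  have hδβ' : ∀ n, Summable (fun j => δ (n + j) * ‖β (n + j + 1)‖ ^ 2) := fun n => by
    have := (summable_nat_add_iff n).2 hδβ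
    simpa only [add_comm _ n] using this
  have hcs : ∀ n, Summable (fun j => (δ (n + j) : ℂ) * β (n + j + 1)) ∧
      ‖∑' j, (δ (n + j) : ℂ) * β (n + j + 1)‖ ^ 2 ≤ ∑' j, δ (n + j) * ‖β (n + j + 1)‖ ^ 2 := by
    intro n
    have := weighted_cauchy_schwarz (w := fun j => δ (n + j))
      (v := fun j => (δ (n + j) : ℂ) * β (n + j + 1)) (x := fun j => β (n + j + 1))
      (fun j => hδ0 _) (hδ1 n).1 (hδβ' n)
      (fun j => by rw [norm_mul, Complex.norm_real, Real.norm_of_nonneg (hδ0 _)])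
    exact ⟨this.1, this.2.trans (mul_le_of_le_one_left
      (tsum_nonneg fun j => mul_nonneg (hδ0 _) (sq_nonneg _)) (hδ1 n).2)⟩
  set T : ℕ → ℂ := fun n => ∑' j, (δ (n + j) : ℂ) * β (n + j + 1) with hT
  have hTs : ∀ n, T n = (δ n : ℂ) * β (n + 1) + T (n + 1) := by
    intro n
    simp only [hT]
    rw [(hcs n).1.tsum_eq_zero_add]
    simp only [add_zero]
    congr 2; ext j
    rw [show n + (j + 1) = n + 1 + j by ring]
  have hdiff : (fun n => (ρ n : ℂ) * (β n - β (n + 1))) =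
      fun n => (fun n => (ρ n : ℂ) * β n + T n) n - (fun n => (ρ n : ℂ) * β n + T n) (n + 1) := by
    ext n
    simp only [hTs n, hδ]
    push_cast; ring
  rw [hdiff]
  refine (seqEnergy_diff_le _).trans ((l2_add_le _ _).trans ?_)
  have hT2 : l2 T ≤ ∑' n, ENNReal.ofReal (ρ n * ‖β n‖ ^ 2) := by
    calc l2 T ≤ ∑' n, ∑' j, (fun k => ENNReal.ofReal (δ k * ‖β (k + 1)‖ ^ 2)) (n + j) := by
          refine ENNReal.tsum_le_tsum fun n => ?_
          rw [← ENNReal.ofReal_tsum_of_nonneg (fun j => mul_nonneg (hδ0 _) (sq_nonneg _)) (hδβ' n)]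
          exact ENNReal.ofReal_le_ofReal (hcs n).2
      _ = ∑' k : ℕ, ((k : ℝ≥0∞) + 1) * ENNReal.ofReal (δ k * ‖β (k + 1)‖ ^ 2) :=
          tsum_tsum_add fun k => ENNReal.ofReal (δ k * ‖β (k + 1)‖ ^ 2)
      _ ≤ ∑' k, ENNReal.ofReal (ρ (k + 1) * ‖β (k + 1)‖ ^ 2) := by
          refine ENNReal.tsum_le_tsum fun k => ?_
          rw [show ((k : ℝ≥0∞) + 1) = ENNReal.ofReal ((k : ℝ) + 1) by
            rw [ENNReal.ofReal_add (by positivity) (by positivity)]; simp,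
            ← ENNReal.ofReal_mul (by positivity), ← mul_assoc]
          exact ENNReal.ofReal_le_ofReal (mul_le_mul_of_nonneg_right (hconc k) (sq_nonneg _))
      _ ≤ _ := ENNReal.tsum_comp_le_tsum_of_injective (add_left_injective 1)
          (fun n => ENNReal.ofReal (ρ n * ‖β n‖ ^ 2))
  have hρ2 : l2 (fun n => (ρ n : ℂ) * β n) ≤ ∑' n, ENNReal.ofReal (ρ n * ‖β n‖ ^ 2) := by
    refine ENNReal.tsum_le_tsum fun n => ENNReal.ofReal_le_ofReal ?_
    rw [norm_mul, mul_pow, Complex.norm_real, Real.norm_of_nonneg (h0 n)]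
    exact mul_le_mul_of_nonneg_right (by nlinarith [h0 n, h1 n]) (sq_nonneg _)
  calc _ ≤ 2 * ∑' n, ENNReal.ofReal (ρ n * ‖β n‖ ^ 2) +
        2 * ∑' n, ENNReal.ofReal (ρ n * ‖β n‖ ^ 2) := by gcongr
    _ = 4 * ∑' n, ENNReal.ofReal (ρ n * ‖β n‖ ^ 2) := by rw [← add_mul]; norm_num
    _ = _ := by
      rw [← ENNReal.tsum_mul_left]
      congr 1; ext n
      rw [mul_assoc, ENNReal.ofReal_mul (p := 4) (by norm_num), ENNReal.ofReal_ofNat]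

lemma l2_geometric_le {w : ℂ} (hw : ‖w‖ < 1) {x : ℕ → ℂ} (hx : l2 x ≠ ⊤) :
    (∀ n, Summable fun j => w ^ j * x (n + j)) ∧
    l2 (fun n => ∑' j, w ^ j * x (n + j)) ≤ ENNReal.ofReal (((1 - ‖w‖)⁻¹) ^ 2) * l2 x := by
  have hg := hasSum_geometric_of_lt_one (norm_nonneg w) hw
  have hxs := summable_of_l2_ne_top hx
  have hxs' : ∀ n, Summable (fun j => ‖w‖ ^ j * ‖x (n + j)‖ ^ 2) := fun n => by
    refine Summable.of_nonneg_of_le (fun j => by positivity)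
      (fun j => mul_le_of_le_one_left (sq_nonneg _) (pow_le_one₀ (norm_nonneg w) hw.le)) ?_
    have := (summable_nat_add_iff n).2 hxs
    simpa only [add_comm _ n] using this
  have hcs := fun n => weighted_cauchy_schwarz (w := fun j => ‖w‖ ^ j)
    (v := fun j => w ^ j * x (n + j)) (x := fun j => x (n + j)) (fun j => by positivity)
    hg.summable (hxs' n) (fun j => by rw [norm_mul, norm_pow])
  refine ⟨fun n => (hcs n).1, ?_⟩
  have hC : 0 ≤ (1 - ‖w‖)⁻¹ := inv_nonneg.2 (by linarith)
  calc l2 (fun n => ∑' j, w ^ j * x (n + j))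
      ≤ ∑' n, ENNReal.ofReal ((1 - ‖w‖)⁻¹) *
          ∑' j, ENNReal.ofReal (‖w‖ ^ j) * ENNReal.ofReal (‖x (n + j)‖ ^ 2) := by
        refine ENNReal.tsum_le_tsum fun n => ?_
        simp only [← ENNReal.ofReal_mul (pow_nonneg (norm_nonneg w) _)]
        rw [← ENNReal.ofReal_tsum_of_nonneg (fun j => by positivity) (hxs' n),
          ← ENNReal.ofReal_mul hC, ← hg.tsum_eq]
        exact ENNReal.ofReal_le_ofReal (hcs n).2
    _ = ENNReal.ofReal ((1 - ‖w‖)⁻¹) *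
          ∑' j, ENNReal.ofReal (‖w‖ ^ j) * ∑' n, ENNReal.ofReal (‖x (n + j)‖ ^ 2) := by
        rw [ENNReal.tsum_mul_left, ENNReal.tsum_comm]
        simp only [ENNReal.tsum_mul_left]
    _ ≤ ENNReal.ofReal ((1 - ‖w‖)⁻¹) * ∑' j, ENNReal.ofReal (‖w‖ ^ j) * l2 x := by
        gcongr with j
        exact ENNReal.tsum_comp_le_tsum_of_injective (add_left_injective j)
          (fun n => ENNReal.ofReal (‖x n‖ ^ 2))
    _ = _ := by
        rw [ENNReal.tsum_mul_right, ← ENNReal.ofReal_tsum_of_nonneg (fun j => by positivity)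
          hg.summable, hg.tsum_eq, ← mul_assoc, ← ENNReal.ofReal_mul hC, sq]

lemma mem_disc {z : ℂ} : z ∈ disc ↔ ‖z‖ < 1 := by simp [disc]

lemma isOpen_disc : IsOpen disc := Metric.isOpen_ball

lemma mem_circleT {z : ℂ} : z ∈ circleT ↔ ‖z‖ = 1 := by simp [circleT]

lemma hasSum_of_eq {f g : ℕ → ℂ} {a : ℂ} (h : HasSum f a) (hfg : ∀ n, g n = f n) :
    HasSum g a := by rwa [funext hfg]

/-- `a` is the sequence of Taylor coefficients of `f` on the unit disc. -/
def HasCoef (f : ℂ → ℂ) (a : ℕ → ℂ) : Prop :=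
  ∀ z ∈ disc, HasSum (fun n => a n * z ^ n) (f z)

lemma exists_hasCoef {f : ℂ → ℂ} (hf : DifferentiableOn ℂ f disc) : ∃ a, HasCoef f a := by
  refine ⟨fun n => (n.factorial : ℂ)⁻¹ * iteratedDeriv n f 0, fun z hz => ?_⟩
  have := Complex.hasSum_taylorSeries_on_ball hf hz
  refine hasSum_of_eq this fun n => ?_
  simp only [sub_zero, smul_eq_mul]; ring

lemma HasCoef.congr {f g : ℂ → ℂ} {a : ℕ → ℂ} (h : HasCoef f a) (hfg : ∀ z ∈ disc, f z = g z) :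
    HasCoef g a := fun z hz => hfg z hz ▸ h z hz

lemma HasCoef.summable_norm {f : ℂ → ℂ} {a : ℕ → ℂ} (h : HasCoef f a) {r : ℝ} (h0 : 0 ≤ r)
    (h1 : r < 1) : Summable fun n => ‖a n‖ * r ^ n := by
  have := (h (r : ℂ) (by simpa [mem_disc, abs_of_nonneg h0] using h1)).summable.norm
  simpa [abs_of_nonneg h0] using this

lemma HasCoef.hasFPowerSeriesOnBall {f : ℂ → ℂ} {a : ℕ → ℂ} (h : HasCoef f a) :
    HasFPowerSeriesOnBall f (FormalMultilinearSeries.ofScalars ℂ a) 0 1 where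
  r_le := by
    refine ENNReal.le_of_forall_nnreal_lt fun r hr => ?_
    refine FormalMultilinearSeries.le_radius_of_summable_norm _ ?_
    simp only [FormalMultilinearSeries.ofScalars_norm]
    exact h.summable_norm r.2 (by exact_mod_cast hr)
  r_pos := one_pos
  hasSum := by
    intro y hy
    have hy' : y ∈ disc := by
      rw [mem_disc]
      rw [Metric.mem_eball, edist_zero_right] at hy
      exact_mod_cast (enorm_lt_coe (r := 1)).1 hy
    simpa [FormalMultilinearSeries.ofScalars_apply_eq, zero_add, mul_comm] using h y hy'

lemma HasCoef.differentiableOn {f : ℂ → ℂ} {a : ℕ → ℂ} (h : HasCoef f a) :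
    DifferentiableOn ℂ f disc := by
  refine h.hasFPowerSeriesOnBall.differentiableOn.mono fun z hz => ?_
  rw [mem_disc] at hz
  rw [Metric.mem_eball, edist_zero_right]
  exact (enorm_lt_coe (r := 1)).2 (by exact_mod_cast hz)

lemma HasCoef.unique {f : ℂ → ℂ} {a b : ℕ → ℂ} (ha : HasCoef f a) (hb : HasCoef f b) : a = b := by
  have := ha.hasFPowerSeriesOnBall.hasFPowerSeriesAt.eq_formalMultilinearSeries
    hb.hasFPowerSeriesOnBall.hasFPowerSeriesAt
  exact FormalMultilinearSeries.ofScalars_series_injective ℂ ℂ this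

lemma HasCoef.eq_iteratedDeriv {f : ℂ → ℂ} {a : ℕ → ℂ} (h : HasCoef f a) (n : ℕ) :
    a n = (n.factorial : ℂ)⁻¹ * iteratedDeriv n f 0 := by
  have h2 : HasCoef f (fun n => (n.factorial : ℂ)⁻¹ * iteratedDeriv n f 0) := fun z hz => by
    have := Complex.hasSum_taylorSeries_on_ball h.differentiableOn hz
    refine hasSum_of_eq this fun n => ?_
    simp only [sub_zero, smul_eq_mul]; ring
  exact congr_fun (h.unique h2) n

lemma HasCoef.deriv {f : ℂ → ℂ} {a : ℕ → ℂ} (h : HasCoef f a) :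
    HasCoef (deriv f) (fun n => ((n : ℂ) + 1) * a (n + 1)) := by
  have hd : DifferentiableOn ℂ (_root_.deriv f) disc := h.differentiableOn.deriv isOpen_disc
  obtain ⟨b, hb⟩ := exists_hasCoef hd
  convert hb using 1
  ext n
  rw [hb.eq_iteratedDeriv, h.eq_iteratedDeriv, iteratedDeriv_succ', Nat.factorial_succ]
  have : ((n : ℂ) + 1) ≠ 0 := Nat.cast_add_one_ne_zero n
  push_cast
  field_simp

lemma HasCoef.add {f g : ℂ → ℂ} {a b : ℕ → ℂ} (hf : HasCoef f a) (hg : HasCoef g b) :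
    HasCoef (fun z => f z + g z) (fun n => a n + b n) := fun z hz => by
  simpa only [add_mul] using (hf z hz).add (hg z hz)

lemma HasCoef.const_mul {f : ℂ → ℂ} {a : ℕ → ℂ} (c : ℂ) (hf : HasCoef f a) :
    HasCoef (fun z => c * f z) (fun n => c * a n) := fun z hz => by
  simpa only [mul_assoc] using (hf z hz).mul_left c

lemma HasCoef.mul {f g : ℂ → ℂ} {a b : ℕ → ℂ} (hf : HasCoef f a) (hg : HasCoef g b) :
    HasCoef (fun z => f z * g z) (fun n => ∑ k ∈ Finset.range (n + 1), a k * b (n - k)) := by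
  intro z hz
  have := hasSum_sum_range_mul_of_summable_norm (hf z hz).summable.norm (hg z hz).summable.norm
  rw [(hf z hz).tsum_eq, (hg z hz).tsum_eq] at this
  refine hasSum_of_eq this fun n => ?_
  rw [Finset.sum_mul]
  refine Finset.sum_congr rfl fun k hk => ?_
  rw [show n = k + (n - k) by have := Finset.mem_range.1 hk; omega, pow_add]
  simp only [Nat.add_sub_cancel_left]
  ring

lemma hasCoef_polynomial (q : Polynomial ℂ) : HasCoef (fun z => q.eval z) q.coeff := fun z _ => by
  simp only [Polynomial.eval_eq_sum_range]
  refine hasSum_sum_of_ne_finset_zero fun n hn => ?_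
  rw [Polynomial.coeff_eq_zero_of_natDegree_lt (by simpa using hn), zero_mul]

lemma hasCoef_geometric {w : ℂ} (hw : ‖w‖ ≤ 1) :
    HasCoef (fun z => (1 - w * z)⁻¹) (fun n => w ^ n) := fun z hz => by
  simp only [← mul_pow]
  refine hasSum_geometric_of_norm_lt_one ?_
  rw [norm_mul]
  rw [mem_disc] at hz
  nlinarith [norm_nonneg z, norm_nonneg w]

/-- Fourier coefficients on `(0, 2π]`. -/
def fourierC (u : ℝ → ℂ) (n : ℤ) : ℂ :=
  ((1 / (2 * Real.pi) : ℝ) : ℂ) * ∫ t in (0:ℝ)..(2 * Real.pi), Complex.exp (-(n * t * I)) * u t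

lemma hasSum_sq_fourierC {u : ℝ → ℂ} (hu : MemLp u 2 θm) :
    HasSum (fun n => ‖fourierC u n‖ ^ 2)
      (1 / (2 * Real.pi) * ∫ t in (0:ℝ)..(2 * Real.pi), ‖u t‖ ^ 2) := by
  have h := hasSum_sq_fourierCoeffOn Real.two_pi_pos hu
  simp only [sub_zero, smul_eq_mul, ← one_div] at h
  convert h using 4 with n
  rw [fourierCoeffOn_eq_integral, fourierC, Complex.real_smul, sub_zero]
  congr 1
  refine intervalIntegral.integral_congr fun t _ => ?_
  simp only [fourier_coe_apply, smul_eq_mul]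
  congr 2
  have : (Real.pi : ℂ) ≠ 0 := by exact_mod_cast Real.pi_ne_zero
  push_cast
  field_simp

lemma bpt_pow (t : ℝ) (n : ℕ) : bpt t ^ n = Complex.exp (n * t * I) := by
  rw [bpt, ← Complex.exp_nat_mul]; ring_nf

lemma norm_bpt (t : ℝ) : ‖bpt t‖ = 1 := by
  rw [bpt, mul_comm, Complex.norm_exp_ofReal_mul_I]

lemma continuous_bpt : Continuous bpt := by unfold bpt; fun_prop

lemma integral_exp_int (n : ℤ) : ∫ t in (0:ℝ)..(2 * Real.pi), Complex.exp (n * t * I) =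
    if n = 0 then 2 * Real.pi else 0 := by
  split_ifs with h
  · simp [h]
  · have h1 : (n : ℂ) * I ≠ 0 := by simp [h]
    have := integral_exp_mul_complex (a := 0) (b := 2 * Real.pi) h1
    simp only [mul_right_comm _ I] at this
    rw [this]
    have h2 := Complex.exp_int_mul_two_pi_mul_I n
    rw [show (n : ℂ) * ((2 * Real.pi : ℝ) : ℂ) * I = n * (2 * Real.pi * I) by push_cast; ring, h2]
    simp

instance : IsFiniteMeasure θm := by unfold θm; infer_instance

lemma memLp_of_continuous {u : ℝ → ℂ} (hu : Continuous u) : MemLp u 2 θm := by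
  obtain ⟨C, hC⟩ := (isCompact_Icc (a := (0:ℝ)) (b := 2 * Real.pi)).exists_bound_of_continuousOn
    hu.continuousOn
  refine MemLp.of_bound hu.aestronglyMeasurable C ?_
  exact (ae_restrict_iff' measurableSet_Ioc).2
    (Eventually.of_forall fun t ht => hC t (Ioc_subset_Icc_self ht))

lemma mul_bpt_mem_disc {r : ℝ} (h0 : 0 ≤ r) (h1 : r < 1) (t : ℝ) : (r : ℂ) * bpt t ∈ disc := by
  simpa [mem_disc, norm_bpt, abs_of_nonneg h0] using h1

lemma HasCoef.continuous_circle {f : ℂ → ℂ} {a : ℕ → ℂ} (h : HasCoef f a) {r : ℝ} (h0 : 0 ≤ r)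
    (h1 : r < 1) : Continuous fun t => f (r * bpt t) :=
  h.differentiableOn.continuousOn.comp_continuous (continuous_const.mul continuous_bpt)
    fun t => mul_bpt_mem_disc h0 h1 t

lemma HasCoef.fourierC {f : ℂ → ℂ} {a : ℕ → ℂ} (h : HasCoef f a) {r : ℝ} (h0 : 0 ≤ r)
    (h1 : r < 1) (m : ℤ) : DirichletMu.fourierC (fun t => f (r * bpt t)) m =
      if 0 ≤ m then a m.toNat * r ^ m.toNat else 0 := by
  have hs := h.summable_norm h0 h1
  have key : HasSum (fun n : ℕ => ∫ t in (0:ℝ)..(2 * Real.pi),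
      Complex.exp (-(m * t * I)) * (a n * (r * bpt t) ^ n))
      (∫ t in (0:ℝ)..(2 * Real.pi), Complex.exp (-(m * t * I)) * f (r * bpt t)) := by
    refine intervalIntegral.hasSum_integral_of_dominated_convergence
      (fun n _ => ‖a n‖ * r ^ n) (fun n => ?_) (fun n => ?_) ?_ ?_ ?_
    · refine Continuous.aestronglyMeasurable ?_
      have := continuous_bpt
      fun_prop
    · refine Eventually.of_forall fun t _ => ?_
      rw [norm_mul, norm_mul, norm_pow, norm_mul, norm_bpt, Complex.norm_exp]
      simp [abs_of_nonneg h0]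
    · exact Eventually.of_forall fun t _ => hs
    · exact intervalIntegrable_const
    · exact Eventually.of_forall fun t _ => (h _ (mul_bpt_mem_disc h0 h1 t)).mul_left _
  have hterm : ∀ n : ℕ, ∫ t in (0:ℝ)..(2 * Real.pi),
      Complex.exp (-(m * t * I)) * (a n * (r * bpt t) ^ n) =
      if (n : ℤ) = m then a n * r ^ n * (2 * Real.pi) else 0 := by
    intro n
    have : ∀ t : ℝ, Complex.exp (-(m * t * I)) * (a n * (r * bpt t) ^ n) =
        a n * r ^ n * Complex.exp (((n - m : ℤ) : ℂ) * t * I) := fun t => by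
      rw [mul_pow, bpt_pow]
      rw [show (((n - m : ℤ) : ℂ) * t * I) = n * t * I + -(m * t * I) by push_cast; ring,
        Complex.exp_add]
      ring
    simp only [this]
    rw [intervalIntegral.integral_const_mul, integral_exp_int]
    simp only [sub_eq_zero]
    split_ifs <;> simp
  simp only [hterm] at key
  rw [DirichletMu.fourierC, ← key.tsum_eq]
  have hpi : (Real.pi : ℂ) ≠ 0 := by exact_mod_cast Real.pi_ne_zero
  split_ifs with hm
  · rw [tsum_eq_single m.toNat fun n hn => if_neg fun hnm => hn (by omega), if_pos (by omega)]
    push_cast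
    field_simp
  · have : ∀ n : ℕ, (if (n : ℤ) = m then a n * (r : ℂ) ^ n * (2 * Real.pi) else 0) = 0 :=
      fun n => if_neg (by omega)
    simp [this]

lemma HasCoef.hasSum_circle {f : ℂ → ℂ} {a : ℕ → ℂ} (h : HasCoef f a) {r : ℝ} (h0 : 0 ≤ r)
    (h1 : r < 1) : HasSum (fun n => ‖a n‖ ^ 2 * r ^ (2 * n))
      (1 / (2 * Real.pi) * ∫ t in (0:ℝ)..(2 * Real.pi), ‖f (r * bpt t)‖ ^ 2) := by
  have hc := h.continuous_circle h0 h1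
  have hL : MemLp (fun t => f (r * bpt t)) 2 θm := memLp_of_continuous hc
  have hP := hasSum_sq_fourierC hL
  simp only [h.fourierC h0 h1] at hP
  rw [← (Nat.cast_injective (R := ℤ)).hasSum_iff] at hP
  · convert hP using 2 with n
    simp [mul_pow, abs_of_nonneg h0, ← pow_mul, mul_comm]
  · intro m hm
    rw [if_neg]
    · simp
    · intro h
      exact hm ⟨m.toNat, by simp [h]⟩

lemma HasCoef.hardySet_eq {f : ℂ → ℂ} {a : ℕ → ℂ} (h : HasCoef f a) :
    hardySet f = {x | ∃ r : ℝ, 0 < r ∧ r < 1 ∧ x = ∑' n, ‖a n‖ ^ 2 * r ^ (2 * n)} := by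
  ext x
  refine exists_congr fun r => and_congr_right fun h0 => and_congr_right fun h1 => ?_
  rw [(h.hasSum_circle h0.le h1).tsum_eq]

lemma HasCoef.isLUB_hardySet {f : ℂ → ℂ} {a : ℕ → ℂ} (h : HasCoef f a) (ha : l2 a ≠ ⊤) :
    IsLUB (hardySet f) (l2 a).toReal := by
  have hs := summable_of_l2_ne_top ha
  have hl : (l2 a).toReal = ∑' n, ‖a n‖ ^ 2 := by
    rw [l2, ← ENNReal.ofReal_tsum_of_nonneg (fun _ => sq_nonneg _) hs,
      ENNReal.toReal_ofReal (tsum_nonneg fun _ => sq_nonneg _)]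
  rw [hl, h.hardySet_eq]
  constructor
  · rintro _ ⟨r, h0, h1, rfl⟩
    have hle : ∀ n, ‖a n‖ ^ 2 * r ^ (2 * n) ≤ ‖a n‖ ^ 2 := fun n =>
      mul_le_of_le_one_right (sq_nonneg _) (pow_le_one₀ h0.le h1.le)
    exact (Summable.of_nonneg_of_le (fun n => by positivity) hle hs).tsum_le_tsum hle hs
  · intro M hM
    refine hs.tsum_le_of_sum_range_le fun N => ?_
    have ht : Tendsto (fun r : ℝ => ∑ n ∈ Finset.range N, ‖a n‖ ^ 2 * r ^ (2 * n)) (𝓝[<] 1)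
        (𝓝 (∑ n ∈ Finset.range N, ‖a n‖ ^ 2 * 1 ^ (2 * n))) := by
      refine Tendsto.mono_left (Continuous.tendsto ?_ 1) nhdsWithin_le_nhds
      fun_prop
    simp only [one_pow, mul_one] at ht
    refine le_of_tendsto ht ?_
    filter_upwards [Ioo_mem_nhdsLT (zero_lt_one (α := ℝ))] with r hr
    refine le_trans ?_ (hM ⟨r, hr.1, hr.2, rfl⟩)
    exact (h.hasSum_circle hr.1.le hr.2).summable.sum_le_tsum _ fun n _ =>
      mul_nonneg (sq_nonneg _) (pow_nonneg hr.1.le _)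

lemma HasCoef.memHardy2_iff {f : ℂ → ℂ} {a : ℕ → ℂ} (h : HasCoef f a) :
    MemHardy2 f ↔ l2 a ≠ ⊤ := by
  constructor
  · rintro ⟨-, M, hM⟩
    refine ne_top_of_le_ne_top ENNReal.ofReal_ne_top (b := ENNReal.ofReal M)
      (ENNReal.tsum_le_of_sum_range_le fun N => ?_)
    rw [← ENNReal.ofReal_sum_of_nonneg fun n _ => by positivity]
    refine ENNReal.ofReal_le_ofReal ?_
    have ht : Tendsto (fun r : ℝ => ∑ n ∈ Finset.range N, ‖a n‖ ^ 2 * r ^ (2 * n)) (𝓝[<] 1)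
        (𝓝 (∑ n ∈ Finset.range N, ‖a n‖ ^ 2 * 1 ^ (2 * n))) := by
      refine Tendsto.mono_left (Continuous.tendsto ?_ 1) nhdsWithin_le_nhds
      fun_prop
    simp only [one_pow, mul_one] at ht
    refine le_of_tendsto ht ?_
    filter_upwards [Ioo_mem_nhdsLT (zero_lt_one (α := ℝ))] with r hr
    rw [h.hardySet_eq] at hM
    refine le_trans ?_ (hM ⟨r, hr.1, hr.2, rfl⟩)
    exact (h.hasSum_circle hr.1.le hr.2).summable.sum_le_tsum _ fun n _ =>
      mul_nonneg (sq_nonneg _) (pow_nonneg hr.1.le _)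
  · intro ha
    exact ⟨h.differentiableOn, (h.isLUB_hardySet ha).bddAbove⟩

lemma HasCoef.hardyNormSq_eq {f : ℂ → ℂ} {a : ℕ → ℂ} (h : HasCoef f a) (ha : l2 a ≠ ⊤) :
    hardyNormSq f = (l2 a).toReal :=
  (h.isLUB_hardySet ha).csSup_eq ⟨_, 1 / 2, by norm_num, by norm_num, rfl⟩

lemma HasCoef.norm_sq_le {f : ℂ → ℂ} {a : ℕ → ℂ} (h : HasCoef f a) {z : ℂ} (hz : z ∈ disc) :
    ENNReal.ofReal (‖f z‖ ^ 2) ≤ ENNReal.ofReal ((1 - ‖z‖ ^ 2)⁻¹) * l2 a := by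
  have hz1 : ‖z‖ < 1 := mem_disc.1 hz
  have hz2 : ‖z‖ ^ 2 < 1 := by nlinarith [norm_nonneg z]
  rcases eq_or_ne (l2 a) ⊤ with ha | ha
  · rw [ha, ENNReal.mul_top]
    · exact le_top
    · simpa using hz2
  have hs := summable_of_l2_ne_top ha
  have hg := hasSum_geometric_of_lt_one (sq_nonneg ‖z‖) hz2
  rw [l2, ← ENNReal.ofReal_tsum_of_nonneg (fun _ => sq_nonneg _) hs,
    ← ENNReal.ofReal_mul (inv_nonneg.2 (by linarith)), ← hg.tsum_eq]
  refine ENNReal.ofReal_le_ofReal ?_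
  refine le_of_tendsto ((h z hz).tendsto_sum_nat.norm.pow 2) (Eventually.of_forall fun N => ?_)
  calc ‖∑ n ∈ Finset.range N, a n * z ^ n‖ ^ 2
      ≤ (∑ n ∈ Finset.range N, ‖z‖ ^ n * ‖a n‖) ^ 2 := by
        gcongr
        refine (norm_sum_le _ _).trans (le_of_eq (Finset.sum_congr rfl fun n _ => ?_))
        rw [norm_mul, norm_pow, mul_comm]
    _ ≤ (∑ n ∈ Finset.range N, (‖z‖ ^ n) ^ 2) * ∑ n ∈ Finset.range N, ‖a n‖ ^ 2 :=
        Finset.sum_mul_sq_le_sq_mul_sq _ _ _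
    _ ≤ _ := by
        simp only [← pow_mul, mul_comm _ 2]
        simp only [pow_mul]
        exact mul_le_mul (hg.summable.sum_le_tsum _ fun n _ => by positivity)
          (hs.sum_le_tsum _ fun n _ => by positivity)
          (Finset.sum_nonneg fun n _ => by positivity) (tsum_nonneg fun n => by positivity)

lemma measurableSet_disc : MeasurableSet disc := isOpen_disc.measurableSet

lemma integral_Ioc_radial (n : ℕ) : ∫ r in (0:ℝ)..1, r * (1 - r ^ 2) * r ^ (2 * n) =
    1 / 2 * (1 / (((n : ℝ) + 1) * (n + 2))) := by
  have : ∀ r : ℝ, r * (1 - r ^ 2) * r ^ (2 * n) = r ^ (2 * n + 1) - r ^ (2 * n + 3) :=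
    fun r => by ring
  simp only [this]
  rw [intervalIntegral.integral_sub (by simp) (by simp), integral_pow, integral_pow]
  push_cast
  field_simp
  simp
  ring

lemma HasCoef.lintegral_circle {f : ℂ → ℂ} {a : ℕ → ℂ} (h : HasCoef f a) {r : ℝ} (h0 : 0 ≤ r)
    (h1 : r < 1) : ∫⁻ θ in Ioo (-Real.pi) Real.pi, ENNReal.ofReal (‖f (r * bpt θ)‖ ^ 2) =
      ENNReal.ofReal (2 * Real.pi) * ∑' n, ENNReal.ofReal (‖a n‖ ^ 2 * r ^ (2 * n)) := by
  have hc : Continuous fun t => ‖f (r * bpt t)‖ ^ 2 := (h.continuous_circle h0 h1).norm.pow 2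
  have hs := h.hasSum_circle h0 h1
  have hper : Function.Periodic (fun t => ‖f (r * bpt t)‖ ^ 2) (2 * Real.pi) := fun t => by
    simp only [bpt]
    rw [show I * ((t + 2 * Real.pi : ℝ) : ℂ) = I * t + 2 * Real.pi * I by push_cast; ring,
      Complex.exp_periodic]
  rw [← ENNReal.ofReal_tsum_of_nonneg (fun n => by positivity) hs.summable, hs.tsum_eq,
    ← ENNReal.ofReal_mul Real.two_pi_pos.le, setLIntegral_congr Ioo_ae_eq_Ioc,
    ← ofReal_integral_eq_lintegral_ofReal (hc.integrableOn_Ioc)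
      (Eventually.of_forall fun t => sq_nonneg _),
    ← intervalIntegral.integral_of_le (by linarith [Real.pi_pos])]
  have := hper.intervalIntegral_add_eq (-Real.pi) 0
  rw [zero_add, show -Real.pi + 2 * Real.pi = Real.pi by ring] at this
  rw [this]
  congr 1
  field_simp

lemma HasCoef.lintegral_disc {k : ℂ → ℂ} {a : ℕ → ℂ} (h : HasCoef k a) :
    ∫⁻ z in disc, ENNReal.ofReal (‖k z‖ ^ 2 * (1 - ‖z‖ ^ 2)) =
      ENNReal.ofReal Real.pi * ∑' n : ℕ, ENNReal.ofReal (‖a n‖ ^ 2 / ((n + 1) * (n + 2))) := by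
  set K : ℂ → ℝ≥0∞ := disc.indicator fun z => ENNReal.ofReal (‖k z‖ ^ 2 * (1 - ‖z‖ ^ 2)) with hK
  have hKm : Measurable K := by
    classical
    rw [hK, ← Set.piecewise_eq_indicator]
    refine ContinuousOn.measurable_piecewise ?_ continuousOn_const measurableSet_disc
    have := h.differentiableOn.continuousOn
    exact ENNReal.continuous_ofReal.comp_continuousOn (by fun_prop)
  have hpol : ∀ r θ : ℝ, Complex.polarCoord.symm (r, θ) = r * bpt θ := fun r θ => by
    rw [Complex.polarCoord_symm_apply, bpt, mul_comm I, Complex.exp_mul_I]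
    push_cast; ring
  have hpolc : Continuous fun p : ℝ × ℝ => (p.1 : ℂ) * bpt p.2 := by
    have := continuous_bpt
    fun_prop
  rw [← lintegral_indicator measurableSet_disc, ← Complex.lintegral_comp_polarCoord_symm,
    polarCoord_target, Measure.volume_eq_prod ℝ ℝ,
    ← Measure.prod_restrict]
  rw [← hK, lintegral_prod _ (by
    have : (fun p : ℝ × ℝ => ENNReal.ofReal p.1 • K (Complex.polarCoord.symm p)) =
        fun p => ENNReal.ofReal p.1 * K (p.1 * bpt p.2) := funext fun p => by
      rw [smul_eq_mul, ← hpol]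
    rw [this]
    exact ((ENNReal.measurable_ofReal.comp measurable_fst).mul
      (hKm.comp hpolc.measurable)).aemeasurable)]
  have hin : ∀ r ∈ Ioi (0:ℝ), ∫⁻ θ in Ioo (-Real.pi) Real.pi,
      ENNReal.ofReal r • K (Complex.polarCoord.symm (r, θ)) =
      (Ioo (0:ℝ) 1).indicator (fun r => ∑' n, ENNReal.ofReal (2 * Real.pi * ‖a n‖ ^ 2) *
        ENNReal.ofReal (r * (1 - r ^ 2) * r ^ (2 * n))) r := by
    intro r hr
    have hr0 : (0:ℝ) < r := hr
    have hn : ∀ θ, ‖(r : ℂ) * bpt θ‖ = r := fun θ => by simp [norm_bpt, abs_of_pos hr0]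
    simp only [hpol, smul_eq_mul]
    by_cases h1 : r < 1
    · have h2 : 0 < 1 - r ^ 2 := by nlinarith
      have : ∀ θ, ENNReal.ofReal r * K (r * bpt θ) =
          ENNReal.ofReal (r * (1 - r ^ 2)) * ENNReal.ofReal (‖k (r * bpt θ)‖ ^ 2) := fun θ => by
        rw [hK, indicator_of_mem (mul_bpt_mem_disc hr0.le h1 θ), hn, ← ENNReal.ofReal_mul hr0.le,
          ← ENNReal.ofReal_mul (by positivity)]
        congr 1; ring
      simp only [this]
      rw [lintegral_const_mul' _ _ ENNReal.ofReal_ne_top, h.lintegral_circle hr0.le h1,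
        indicator_of_mem (show r ∈ Ioo (0:ℝ) 1 from ⟨hr0, h1⟩), ← ENNReal.tsum_mul_left,
        ← ENNReal.tsum_mul_left]
      congr 1; ext n
      rw [← ENNReal.ofReal_mul (by positivity), ← ENNReal.ofReal_mul (by positivity),
        ← ENNReal.ofReal_mul (by positivity)]
      congr 1; ring
    · have : ∀ θ, K (r * bpt θ) = 0 := fun θ => by
        rw [hK, indicator_of_notMem]
        rw [mem_disc, hn]; exact h1
      rw [indicator_of_notMem fun h => h1 h.2]
      simp [this]
  rw [setLIntegral_congr_fun measurableSet_Ioi hin, setLIntegral_indicator measurableSet_Ioo,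
    inter_eq_self_of_subset_left (fun x hx => hx.1), lintegral_tsum fun n => by fun_prop,
    ← ENNReal.tsum_mul_left]
  congr 1; ext n
  rw [lintegral_const_mul' _ _ ENNReal.ofReal_ne_top, setLIntegral_congr Ioo_ae_eq_Ioc,
    ← ofReal_integral_eq_lintegral_ofReal (Continuous.integrableOn_Ioc (by fun_prop)) ?_,
    ← intervalIntegral.integral_of_le zero_le_one, integral_Ioc_radial,
    ← ENNReal.ofReal_mul (by positivity), ← ENNReal.ofReal_mul Real.pi_pos.le]
  · congr 1; field_simp
  · refine (ae_restrict_iff' measurableSet_Ioc).2 (Eventually.of_forall fun r hr => ?_)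
    have h0 : 0 ≤ r := hr.1.le
    have h1 : 0 ≤ 1 - r ^ 2 := by nlinarith [hr.2]
    simp only [Pi.zero_apply]
    positivity

/-- The local Dirichlet integral at `ζ` of the function with Taylor coefficients `a`. -/
def locD (ζ : ℂ) (a : ℕ → ℂ) : ℝ≥0∞ := seqEnergy fun n => a (n + 1) * ζ ^ (n + 1)

/-- The squared norm of `D(μ)` in terms of Taylor coefficients. -/
def coefNormSq (μ : Measure ℂ) (a : ℕ → ℂ) : ℝ≥0∞ := l2 a + ∫⁻ ζ, locD ζ a ∂μ

lemma measurable_locD (a : ℕ → ℂ) : Measurable fun ζ => locD ζ a := by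
  unfold locD seqEnergy
  refine Measurable.tsum fun n => ENNReal.measurable_ofReal.comp ?_
  exact Continuous.measurable (by fun_prop)

lemma ae_norm_eq_one {μ : Measure ℂ} (hμ : OnCircle μ) : ∀ᵐ ζ ∂μ, ‖ζ‖ = 1 := by
  have : ∀ᵐ ζ ∂μ, ζ ∈ circleT := hμ
  exact this.mono fun ζ h => mem_circleT.1 h

lemma HasCoef.lintegral_local {f : ℂ → ℂ} {a : ℕ → ℂ} (h : HasCoef f a) {ζ : ℂ} (hζ : ‖ζ‖ = 1) :
    ∫⁻ z in disc, ENNReal.ofReal (‖_root_.deriv f z‖ ^ 2) *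
      ENNReal.ofReal ((1 - ‖z‖ ^ 2) / ‖1 - (starRingEnd ℂ) ζ * z‖ ^ 2) =
      ENNReal.ofReal Real.pi * locD ζ a := by
  have hk := h.deriv.mul (hasCoef_geometric (w := (starRingEnd ℂ) ζ) (by simp [hζ]))
  have hL := hk.lintegral_disc
  rw [locD, seqEnergy]
  convert hL using 3 with z
  · rw [← ENNReal.ofReal_mul (sq_nonneg _), norm_mul, mul_pow, norm_inv]
    congr 1
    ring
  · ext n
    congr 3
    have hc : (starRingEnd ℂ) ζ * ζ = 1 := by
      rw [mul_comm, Complex.mul_conj, Complex.normSq_eq_norm_sq, hζ]; simp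
    have : ∑ k ∈ Finset.range (n + 1), ((k : ℂ) + 1) * a (k + 1) * (starRingEnd ℂ) ζ ^ (n - k) =
        (starRingEnd ℂ) ζ ^ (n + 1) *
          ∑ k ∈ Finset.range (n + 1), ((k : ℂ) + 1) * (a (k + 1) * ζ ^ (k + 1)) := by
      rw [Finset.mul_sum]
      refine Finset.sum_congr rfl fun k hk => ?_
      have hk' : n + 1 = (n - k) + (k + 1) := by have := Finset.mem_range.1 hk; omega
      rw [hk', pow_add]
      have : (starRingEnd ℂ) ζ ^ (k + 1) * ζ ^ (k + 1) = 1 := by rw [← mul_pow, hc, one_pow]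
      linear_combination (-(((k : ℂ) + 1) * a (k + 1) * (starRingEnd ℂ) ζ ^ (n - k))) * this
    rw [this, norm_mul, norm_pow, RCLike.norm_conj, hζ, one_pow, one_mul]

lemma poissonKernel_nonneg {z ζ : ℂ} (hz : z ∈ disc) :
    0 ≤ (1 - ‖z‖ ^ 2) / ‖1 - (starRingEnd ℂ) ζ * z‖ ^ 2 := by
  have := mem_disc.1 hz
  have : 0 ≤ 1 - ‖z‖ ^ 2 := by nlinarith [norm_nonneg z]
  positivity

lemma measurable_poissonKernel : Measurable fun p : ℂ × ℂ =>
    (1 - ‖p.1‖ ^ 2) / ‖1 - (starRingEnd ℂ) p.2 * p.1‖ ^ 2 := by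
  refine Measurable.div (Continuous.measurable (by fun_prop)) (Continuous.measurable ?_)
  have := Complex.continuous_conj
  fun_prop

lemma ofReal_poissonMu {μ : Measure ℂ} [IsFiniteMeasure μ] (hμ : OnCircle μ) {z : ℂ}
    (hz : z ∈ disc) : ENNReal.ofReal (poissonMu μ z) =
      ∫⁻ ζ, ENNReal.ofReal ((1 - ‖z‖ ^ 2) / ‖1 - (starRingEnd ℂ) ζ * z‖ ^ 2) ∂μ := by
  refine ofReal_integral_eq_lintegral_ofReal ?_
    (Eventually.of_forall fun ζ => poissonKernel_nonneg hz)
  have hz1 := mem_disc.1 hz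
  refine Integrable.of_bound (C := (1 - ‖z‖ ^ 2) / (1 - ‖z‖) ^ 2)
    (measurable_poissonKernel.comp measurable_prodMk_left).aestronglyMeasurable ?_
  filter_upwards [ae_norm_eq_one hμ] with ζ hζ
  rw [Real.norm_of_nonneg (poissonKernel_nonneg hz)]
  have h1 : 0 ≤ 1 - ‖z‖ ^ 2 := by nlinarith [norm_nonneg z]
  have h2 : 1 - ‖z‖ ≤ ‖1 - (starRingEnd ℂ) ζ * z‖ := by
    have := norm_sub_norm_le (1 : ℂ) ((starRingEnd ℂ) ζ * z)
    rwa [norm_mul, RCLike.norm_conj, hζ, one_mul, norm_one] at this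
  have h3 : 0 < 1 - ‖z‖ := by linarith
  gcongr

lemma poissonMu_nonneg {μ : Measure ℂ} {z : ℂ} (hz : z ∈ disc) : 0 ≤ poissonMu μ z :=
  integral_nonneg fun _ => poissonKernel_nonneg hz

lemma measurable_poissonMu (μ : Measure ℂ) [IsFiniteMeasure μ] : Measurable (poissonMu μ) :=
  (StronglyMeasurable.integral_prod_right' measurable_poissonKernel.stronglyMeasurable).measurable

lemma measurable_dirichletDensity (μ : Measure ℂ) [IsFiniteMeasure μ] (f : ℂ → ℂ) :
    Measurable (dirichletDensity μ f) :=
  ((measurable_deriv f).norm.pow_const 2).mul (measurable_poissonMu μ)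

lemma dirichletDensity_nonneg {μ : Measure ℂ} {f : ℂ → ℂ} {z : ℂ} (hz : z ∈ disc) :
    0 ≤ dirichletDensity μ f z := mul_nonneg (sq_nonneg _) (poissonMu_nonneg hz)

lemma HasCoef.lintegral_dirichletDensity {μ : Measure ℂ} [IsFiniteMeasure μ] (hμ : OnCircle μ)
    {f : ℂ → ℂ} {a : ℕ → ℂ} (h : HasCoef f a) :
    ∫⁻ z in disc, ENNReal.ofReal (dirichletDensity μ f z) =
      ENNReal.ofReal Real.pi * ∫⁻ ζ, locD ζ a ∂μ := by
  have h1 : ∀ z ∈ disc, ENNReal.ofReal (dirichletDensity μ f z) =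
      ∫⁻ ζ, ENNReal.ofReal (‖_root_.deriv f z‖ ^ 2) *
        ENNReal.ofReal ((1 - ‖z‖ ^ 2) / ‖1 - (starRingEnd ℂ) ζ * z‖ ^ 2) ∂μ := fun z hz => by
    rw [lintegral_const_mul' _ _ ENNReal.ofReal_ne_top, ← ofReal_poissonMu hμ hz,
      ← ENNReal.ofReal_mul (sq_nonneg _), dirichletDensity]
  rw [setLIntegral_congr_fun measurableSet_disc h1, lintegral_lintegral_swap,
    ← lintegral_const_mul _ (measurable_locD a)]
  · refine lintegral_congr_ae ?_
    filter_upwards [ae_norm_eq_one hμ] with ζ hζ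
    exact h.lintegral_local hζ
  · refine Measurable.aemeasurable ?_
    have hd : Measurable fun p : ℂ × ℂ => ‖_root_.deriv f p.1‖ ^ 2 :=
      ((measurable_deriv f).comp measurable_fst).norm.pow_const 2
    exact (ENNReal.measurable_ofReal.comp hd).mul
      (ENNReal.measurable_ofReal.comp measurable_poissonKernel)

lemma HasCoef.integrableOn_dirichletDensity_iff {μ : Measure ℂ} [IsFiniteMeasure μ]
    (hμ : OnCircle μ) {f : ℂ → ℂ} {a : ℕ → ℂ} (h : HasCoef f a) :
    IntegrableOn (dirichletDensity μ f) disc ↔ ∫⁻ ζ, locD ζ a ∂μ ≠ ⊤ := by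
  have hm := (measurable_dirichletDensity μ f).aestronglyMeasurable (μ := volume.restrict disc)
  have hnn : 0 ≤ᵐ[volume.restrict disc] dirichletDensity μ f :=
    (ae_restrict_iff' measurableSet_disc).2
      (Eventually.of_forall fun z hz => dirichletDensity_nonneg hz)
  rw [IntegrableOn, ← lintegral_ofReal_ne_top_iff_integrable hm hnn,
    h.lintegral_dirichletDensity hμ]
  have hpi : ENNReal.ofReal Real.pi ≠ 0 := by simpa using Real.pi_pos
  constructor
  · intro h1 h2
    exact h1 (by rw [h2, ENNReal.mul_top hpi])
  · exact ENNReal.mul_ne_top ENNReal.ofReal_ne_top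

lemma HasCoef.dirichletIntegral_eq {μ : Measure ℂ} [IsFiniteMeasure μ]
    (hμ : OnCircle μ) {f : ℂ → ℂ} {a : ℕ → ℂ} (h : HasCoef f a) :
    dirichletIntegral μ f = (∫⁻ ζ, locD ζ a ∂μ).toReal := by
  have hm := (measurable_dirichletDensity μ f).aestronglyMeasurable (μ := volume.restrict disc)
  have hnn : 0 ≤ᵐ[volume.restrict disc] dirichletDensity μ f :=
    (ae_restrict_iff' measurableSet_disc).2
      (Eventually.of_forall fun z hz => dirichletDensity_nonneg hz)
  rw [dirichletIntegral, integral_eq_lintegral_of_nonneg_ae hnn hm,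
    h.lintegral_dirichletDensity hμ, ENNReal.toReal_mul, ENNReal.toReal_ofReal Real.pi_pos.le]
  field_simp

lemma HasCoef.memD_iff {μ : Measure ℂ} [IsFiniteMeasure μ] (hμ : OnCircle μ)
    {f : ℂ → ℂ} {a : ℕ → ℂ} (h : HasCoef f a) : MemD μ f ↔ coefNormSq μ a ≠ ⊤ := by
  rw [MemD, h.memHardy2_iff, h.integrableOn_dirichletDensity_iff hμ, coefNormSq, ENNReal.add_ne_top]

lemma HasCoef.ofReal_dNormSq {μ : Measure ℂ} [IsFiniteMeasure μ] (hμ : OnCircle μ)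
    {f : ℂ → ℂ} {a : ℕ → ℂ} (h : HasCoef f a) (ha : coefNormSq μ a ≠ ⊤) :
    ENNReal.ofReal (dNormSq μ f) = coefNormSq μ a := by
  rw [coefNormSq, ENNReal.add_ne_top] at ha
  rw [dNormSq, h.hardyNormSq_eq ha.1, h.dirichletIntegral_eq hμ,
    ENNReal.ofReal_add ENNReal.toReal_nonneg ENNReal.toReal_nonneg, ENNReal.ofReal_toReal ha.1,
    ENNReal.ofReal_toReal ha.2, coefNormSq]

lemma coefNormSq_add_le (μ : Measure ℂ) (a b : ℕ → ℂ) :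
    coefNormSq μ (fun n => a n + b n) ≤ 2 * coefNormSq μ a + 2 * coefNormSq μ b := by
  have h : ∫⁻ ζ, locD ζ (fun n => a n + b n) ∂μ ≤
      2 * ∫⁻ ζ, locD ζ a ∂μ + 2 * ∫⁻ ζ, locD ζ b ∂μ := by
    rw [← lintegral_const_mul _ (measurable_locD a), ← lintegral_const_mul _ (measurable_locD b),
      ← lintegral_add_left ((measurable_locD a).const_mul _)]
    refine lintegral_mono fun ζ => ?_
    simp only [locD, add_mul]
    exact seqEnergy_add_le _ _
  calc _ ≤ (2 * l2 a + 2 * l2 b) + _ := add_le_add (l2_add_le a b) h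
    _ = _ := by simp only [coefNormSq]; ring

lemma coefNormSq_const_mul (μ : Measure ℂ) (c : ℂ) (a : ℕ → ℂ) :
    coefNormSq μ (fun n => c * a n) = ENNReal.ofReal (‖c‖ ^ 2) * coefNormSq μ a := by
  simp only [coefNormSq, l2_const_mul, locD, mul_assoc, seqEnergy_const_mul]
  rw [lintegral_const_mul' _ _ ENNReal.ofReal_ne_top, mul_add]

lemma l2_succ_le (x : ℕ → ℂ) : l2 (fun n => x (n + 1)) ≤ l2 x :=
  ENNReal.tsum_comp_le_tsum_of_injective (add_left_injective 1)
    (fun n => ENNReal.ofReal (‖x n‖ ^ 2))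

lemma l2_eq_zero_add (x : ℕ → ℂ) :
    l2 x = ENNReal.ofReal (‖x 0‖ ^ 2) + l2 (fun n => x (n + 1)) :=
  tsum_eq_zero_add' ENNReal.summable

lemma le_l2 (x : ℕ → ℂ) (n : ℕ) : ENNReal.ofReal (‖x n‖ ^ 2) ≤ l2 x :=
  ENNReal.le_tsum (f := fun n => ENNReal.ofReal (‖x n‖ ^ 2)) n

lemma l2_congr_norm {x y : ℕ → ℂ} (h : ∀ n, ‖x n‖ = ‖y n‖) : l2 x = l2 y := by
  simp only [l2, h]

/-- Taylor coefficients of `z ↦ z f(z)`. -/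
def shiftSeq (a : ℕ → ℂ) : ℕ → ℂ
  | 0 => 0
  | n + 1 => a n

lemma locD_shiftSeq_le {ζ : ℂ} (hζ : ‖ζ‖ = 1) (a : ℕ → ℂ) :
    locD ζ (shiftSeq a) ≤ 3 * locD ζ a + 2 * l2 a := by
  rcases eq_or_ne (locD ζ a) ⊤ with h | h
  · rw [h]; simp
  obtain ⟨β, hβ, hle⟩ := exists_diff_of_seqEnergy_ne_top h
  set b : ℕ → ℂ := fun n => match n with
    | 0 => ζ * (β 0 + a 0)
    | n + 1 => ζ * β n with hb
  have hd : (fun n => shiftSeq a (n + 1) * ζ ^ (n + 1)) = fun n => b n - b (n + 1) := by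
    ext n
    cases n with
    | zero => simp only [hb, shiftSeq]; ring
    | succ n =>
      have := hβ n
      simp only [hb, shiftSeq]
      rw [pow_succ]
      linear_combination ζ * this
  rw [locD, hd]
  refine (seqEnergy_diff_le b).trans ?_
  rw [l2_eq_zero_add]
  have h1 : l2 (fun n => b (n + 1)) = l2 β := l2_congr_norm fun n => by simp [hb, hζ]
  have h2 : ENNReal.ofReal (‖b 0‖ ^ 2) ≤ 2 * l2 β + 2 * l2 a := by
    have : ‖b 0‖ = ‖β 0 + a 0‖ := by simp [hb, hζ]
    rw [this]
    refine (ofReal_norm_add_sq_le _ _).trans ?_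
    gcongr
    · exact le_l2 β 0
    · exact le_l2 a 0
  rw [h1]
  calc _ ≤ 2 * l2 β + 2 * l2 a + l2 β := by gcongr
    _ = 3 * l2 β + 2 * l2 a := by ring
    _ ≤ _ := by gcongr; exact hle

lemma coefNormSq_shiftSeq_le {μ : Measure ℂ} (hμ : OnCircle μ) (a : ℕ → ℂ) :
    coefNormSq μ (shiftSeq a) ≤ (3 + 2 * μ univ) * coefNormSq μ a := by
  have h1 : l2 (shiftSeq a) = l2 a := by
    rw [l2_eq_zero_add]; simp [shiftSeq]
  have h2 : ∫⁻ ζ, locD ζ (shiftSeq a) ∂μ ≤ 3 * ∫⁻ ζ, locD ζ a ∂μ + 2 * l2 a * μ univ := by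
    rw [← lintegral_const_mul _ (measurable_locD a), ← lintegral_const,
      ← lintegral_add_right _ measurable_const]
    refine lintegral_mono_ae ?_
    filter_upwards [ae_norm_eq_one hμ] with ζ hζ
    exact locD_shiftSeq_le hζ a
  calc _ ≤ l2 a + (3 * ∫⁻ ζ, locD ζ a ∂μ + 2 * l2 a * μ univ) := by
        rw [coefNormSq, h1]; gcongr
    _ ≤ l2 a + (3 * ∫⁻ ζ, locD ζ a ∂μ + 2 * l2 a * μ univ) +
        (2 * l2 a + 2 * μ univ * ∫⁻ ζ, locD ζ a ∂μ) := le_self_add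
    _ = _ := by rw [coefNormSq]; ring

lemma HasCoef.X_mul {f : ℂ → ℂ} {a : ℕ → ℂ} (h : HasCoef f a) :
    HasCoef (fun z => z * f z) (shiftSeq a) := fun z hz => by
  have := (h z hz).mul_left z
  rw [← hasSum_nat_add_iff' 1]
  simp only [Finset.range_one, Finset.sum_singleton, shiftSeq, zero_mul, sub_zero]
  exact hasSum_of_eq this fun n => by ring

/-- Coefficients of the quotient of `f` by `z - w`. -/
lemma coef_of_sub_mul {g : ℂ → ℂ} {a b : ℕ → ℂ} {w : ℂ} (hw : w ∈ disc) (hg : HasCoef g b)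
    (ha : HasCoef (fun z => (z - w) * g z) a) (n : ℕ) : b n = ∑' j, w ^ j * a (n + 1 + j) := by
  have hab : a = fun n => shiftSeq b n + (-w) * b n :=
    ha.unique ((hg.X_mul.add (hg.const_mul (-w))).congr fun z _ => by ring)
  have hsum : ∀ n, Summable fun j => w ^ j * a (n + 1 + j) := by
    intro n
    have h1 := ha.summable_norm (norm_nonneg w) (mem_disc.1 hw)
    rcases eq_or_ne w 0 with rfl | hw0
    · refine summable_of_ne_finset_zero (s := {0}) fun j hj => ?_
      rw [zero_pow (by simpa using hj), zero_mul]
    · have h2 := ((ha w hw).summable.comp_injective (add_right_injective (n + 1)))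
      refine (h2.mul_left ((w ^ (n + 1))⁻¹)).congr fun j => ?_
      simp only [Function.comp]
      rw [pow_add]
      field_simp
      ring
  have hy : ∀ n, ∑' j, w ^ j * a (n + 1 + j) =
      a (n + 1) + w * ∑' j, w ^ j * a (n + 1 + 1 + j) := by
    intro n
    rw [(hsum n).tsum_eq_zero_add, ← tsum_mul_left]
    simp only [pow_zero, one_mul, add_zero]
    congr 2; ext j
    rw [pow_succ, show n + 1 + (j + 1) = n + 1 + 1 + j by ring]; ring
  have hs : ∀ n, a (n + 1) = b n - w * b (n + 1) := fun n => by
    rw [hab]; simp only [shiftSeq]; ring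
  have h0 : w * b 0 = w * ∑' j, w ^ j * a (0 + 1 + j) := by
    have h1 := ha w hw
    simp only [sub_self, zero_mul] at h1
    have h2 := h1.summable.tsum_eq_zero_add
    rw [h1.tsum_eq] at h2
    have h3 : a 0 = -w * b 0 := by rw [hab]; simp [shiftSeq]
    rw [← tsum_mul_left]
    have h4 : ∑' j, w * (w ^ j * a (0 + 1 + j)) = ∑' j, a (j + 1) * w ^ (j + 1) := by
      congr 1; ext j
      rw [show 0 + 1 + j = j + 1 by ring, pow_succ]; ring
    rw [h4]
    rw [h3] at h2
    linear_combination h2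
  rcases eq_or_ne w 0 with rfl | hw0
  · rw [hy, hs]; simp
  · induction n with
    | zero => exact mul_left_cancel₀ hw0 h0
    | succ n ih =>
      rw [hy] at ih
      have := hs n
      rw [this] at ih
      exact mul_left_cancel₀ hw0 (by linear_combination ih)

lemma locD_div_le {a b : ℕ → ℂ} {w ζ : ℂ} (hw : w ∈ disc) (hζ : ‖ζ‖ = 1)
    (h : ∀ n, b n = ∑' j, w ^ j * a (n + 1 + j)) :
    locD ζ b ≤ ENNReal.ofReal (((1 - ‖w‖)⁻¹) ^ 2) * locD ζ a := by
  have hC : ENNReal.ofReal (((1 - ‖w‖)⁻¹) ^ 2) ≠ 0 := by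
    have := mem_disc.1 hw
    have : 0 < 1 - ‖w‖ := by linarith
    simpa using this.ne'
  rcases eq_or_ne (locD ζ a) ⊤ with hT | hT
  · rw [hT, ENNReal.mul_top hC]; exact le_top
  obtain ⟨β, hβ, hle⟩ := exists_diff_of_seqEnergy_ne_top hT
  set c := (starRingEnd ℂ) ζ with hc
  have hcζ : c * ζ = 1 := by
    rw [hc, mul_comm, Complex.mul_conj, Complex.normSq_eq_norm_sq, hζ]; simp
  have hcn : ‖c‖ = 1 := by rw [hc, RCLike.norm_conj, hζ]
  have hv : ‖w * c‖ = ‖w‖ := by rw [norm_mul, hcn, mul_one]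
  have hv1 : ‖w * c‖ < 1 := by rw [hv]; exact mem_disc.1 hw
  have hβ1 : l2 (fun n => β (n + 1)) ≠ ⊤ :=
    ne_top_of_le_ne_top hT ((l2_succ_le β).trans hle)
  have hgeo := l2_geometric_le hv1 hβ1
  set y : ℕ → ℂ := fun n => ∑' j, (w * c) ^ j * β (n + j + 1) with hy
  have hd : (fun n => b (n + 1) * ζ ^ (n + 1)) = fun n => c * (y n - y (n + 1)) := by
    ext n
    rw [h, ← tsum_mul_right]
    simp only [hy]
    rw [← (hgeo.1 n).tsum_sub (hgeo.1 (n + 1)), ← tsum_mul_left]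
    congr 1; ext j
    have h1 := hβ (n + j + 1)
    rw [show n + 1 + 1 + j = n + j + 1 + 1 by ring, show n + 1 + j + 1 = n + j + 1 + 1 by ring,
      ← mul_sub, ← h1, show n + j + 1 + 1 = (n + 1) + (j + 1) by ring, pow_add, mul_pow]
    have h2 : c ^ (j + 1) * ζ ^ (j + 1) = 1 := by rw [← mul_pow, hcζ, one_pow]
    rw [pow_succ c] at h2
    linear_combination (-(w ^ j * a (n + 1 + (j + 1)) * ζ ^ (n + 1))) * h2
  rw [locD, hd, seqEnergy_const_mul, hcn]
  simp only [one_pow, ENNReal.ofReal_one, one_mul]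
  rw [← hv]
  calc _ ≤ l2 y := seqEnergy_diff_le y
    _ ≤ _ := hgeo.2
    _ ≤ _ := by gcongr; exact (l2_succ_le β).trans hle

lemma coefNormSq_div_le {μ : Measure ℂ} (hμ : OnCircle μ) {a b : ℕ → ℂ} {w : ℂ} (hw : w ∈ disc)
    (h : ∀ n, b n = ∑' j, w ^ j * a (n + 1 + j)) :
    coefNormSq μ b ≤ ENNReal.ofReal (((1 - ‖w‖)⁻¹) ^ 2) * coefNormSq μ a := by
  have hC : ENNReal.ofReal (((1 - ‖w‖)⁻¹) ^ 2) ≠ 0 := by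
    have := mem_disc.1 hw
    have : 0 < 1 - ‖w‖ := by linarith
    simpa using this.ne'
  rw [coefNormSq, coefNormSq, mul_add]
  gcongr
  · rcases eq_or_ne (l2 a) ⊤ with hT | hT
    · rw [hT, ENNReal.mul_top hC]; exact le_top
    have h1 := l2_geometric_le (mem_disc.1 hw)
      (x := fun n => a (n + 1)) (ne_top_of_le_ne_top hT (l2_succ_le a))
    have h2 : b = fun n => ∑' j, w ^ j * a (n + j + 1) := by
      ext n; rw [h]; simp only [add_right_comm]
    rw [h2]
    exact h1.2.trans (by gcongr; exact l2_succ_le a)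
  · rw [← lintegral_const_mul _ (measurable_locD a)]
    refine lintegral_mono_ae ?_
    filter_upwards [ae_norm_eq_one hμ] with ζ hζ
    exact locD_div_le hw hζ h

/-- The Fejér-type multipliers `min (1, (n+1)/N)`. -/
def fejer (N n : ℕ) : ℝ := min 1 (((n : ℝ) + 1) / (N + 1))

lemma fejer_nonneg (N n : ℕ) : 0 ≤ fejer N n := le_min zero_le_one (by positivity)

lemma fejer_le_one (N n : ℕ) : fejer N n ≤ 1 := min_le_left _ _

lemma fejer_mono (N : ℕ) : Monotone (fejer N) := fun m n h => by
  unfold fejer; gcongr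

lemma fejer_conc (N n : ℕ) :
    ((n : ℝ) + 1) * (fejer N (n + 1) - fejer N n) ≤ fejer N (n + 1) := by
  have hN : (0:ℝ) < N + 1 := by positivity
  rcases le_or_gt N n with h | h
  · have h1 : fejer N n = 1 := min_eq_left (by
      rw [le_div_iff₀ hN]; have : (N : ℝ) ≤ n := by exact_mod_cast h
      linarith)
    have h2 : fejer N (n + 1) = 1 :=
      le_antisymm (fejer_le_one _ _) (h1 ▸ fejer_mono N (Nat.le_succ n))
    rw [h1, h2]; simp
  · have h' : (n : ℝ) + 1 ≤ N := by exact_mod_cast h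
    have h1 : fejer N n = ((n : ℝ) + 1) / (N + 1) := min_eq_right (by
      rw [div_le_one hN]; linarith)
    have h2 : fejer N (n + 1) = ((n : ℝ) + 2) / (N + 1) := by
      unfold fejer
      rw [min_eq_right]
      · push_cast; ring
      · rw [div_le_one hN]; push_cast; linarith
    rw [h1, h2, ← sub_div, ← mul_div_assoc]
    gcongr
    linarith

lemma fejer_tendsto (n : ℕ) : Tendsto (fun N => fejer N n) atTop (𝓝 0) := by
  have h : Tendsto (fun N : ℕ => ((n : ℝ) + 1) / (N + 1)) atTop (𝓝 0) :=
    tendsto_const_nhds.div_atTop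
      (tendsto_atTop_add_const_right _ _ tendsto_natCast_atTop_atTop)
  exact squeeze_zero (fun N => fejer_nonneg N n) (fun N => min_le_right _ _) h

lemma tendsto_tsum_fejer {x : ℕ → ℂ} (hx : l2 x ≠ ⊤) (C : ℝ) :
    Tendsto (fun N => ∑' n, ENNReal.ofReal (C * fejer N n * ‖x n‖ ^ 2)) atTop (𝓝 0) := by
  simp only [← lintegral_count (α := ℕ)]
  have hz : (0 : ℝ≥0∞) = ∫⁻ n : ℕ, 0 ∂Measure.count := by simp
  rw [hz]
  refine tendsto_lintegral_of_dominated_convergence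
    (fun n => ENNReal.ofReal |C| * ENNReal.ofReal (‖x n‖ ^ 2))
    (fun N => measurable_of_countable _) (fun N => Eventually.of_forall fun n => ?_) ?_
    (Eventually.of_forall fun n => ?_)
  · simp only
    rw [← ENNReal.ofReal_mul (abs_nonneg C)]
    refine ENNReal.ofReal_le_ofReal (mul_le_mul_of_nonneg_right ?_ (sq_nonneg _))
    calc C * fejer N n ≤ |C| * fejer N n :=
          mul_le_mul_of_nonneg_right (le_abs_self C) (fejer_nonneg N n)
      _ ≤ |C| := mul_le_of_le_one_right (abs_nonneg C) (fejer_le_one N n)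
  · rw [lintegral_const_mul' _ _ ENNReal.ofReal_ne_top, lintegral_count]
    exact ENNReal.mul_ne_top ENNReal.ofReal_ne_top hx
  · have := ((fejer_tendsto n).const_mul C).mul_const (‖x n‖ ^ 2)
    simpa using ENNReal.tendsto_ofReal this

lemma locD_fejer_le {ζ : ℂ} {a β : ℕ → ℂ} (hl : l2 β ≠ ⊤)
    (hβ : ∀ n, a (n + 1) * ζ ^ (n + 1) = β n - β (n + 1)) (N : ℕ) :
    locD ζ (fun n => if n = 0 then 0 else fejer N (n - 1) * a n) ≤
      ∑' n, ENNReal.ofReal (4 * fejer N n * ‖β n‖ ^ 2) := by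
  have := seqEnergy_mul_le hl (fejer_nonneg N) (fejer_le_one N) (fejer_mono N) (fejer_conc N)
  simp only [← hβ] at this
  simpa [locD, mul_assoc] using this

/-- Polynomials are dense in `D(μ)`. -/
lemma exists_polynomial_near {μ : Measure ℂ} {a : ℕ → ℂ} (ha : coefNormSq μ a ≠ ⊤) {ε : ℝ≥0∞}
    (hε : 0 < ε) : ∃ q : Polynomial ℂ, coefNormSq μ (fun n => a n - q.coeff n) < ε := by
  rw [coefNormSq, ENNReal.add_ne_top] at ha
  set m : ℕ → ℕ → ℂ := fun N n => if n = 0 then 0 else fejer N (n - 1) * a n with hm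
  have hlim1 : Tendsto (fun N => l2 (m N)) atTop (𝓝 0) := by
    have h := tendsto_tsum_fejer
      (x := fun n => a (n + 1)) (ne_top_of_le_ne_top ha.1 (l2_succ_le a)) 1
    refine tendsto_of_tendsto_of_tendsto_of_le_of_le tendsto_const_nhds h
      (fun N => bot_le) fun N => ?_
    simp only
    rw [l2_eq_zero_add]
    simp only [hm, if_true, norm_zero, ne_eq, OfNat.ofNat_ne_zero, not_false_eq_true, zero_pow,
      ENNReal.ofReal_zero, zero_add]
    refine ENNReal.tsum_le_tsum fun n => ENNReal.ofReal_le_ofReal ?_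
    have h0 := fejer_nonneg N n
    simp only [Nat.succ_ne_zero, if_false, Nat.add_sub_cancel]
    rw [norm_mul, mul_pow, Complex.norm_real, Real.norm_of_nonneg h0, one_mul]
    exact mul_le_mul_of_nonneg_right (by nlinarith [fejer_le_one N n]) (sq_nonneg _)
  have hlim2 : Tendsto (fun N => ∫⁻ ζ, locD ζ (m N) ∂μ) atTop (𝓝 0) := by
    have hz : (0 : ℝ≥0∞) = ∫⁻ ζ, 0 ∂μ := by simp
    rw [hz]
    have hfin : ∀ᵐ ζ ∂μ, locD ζ a < ⊤ := ae_lt_top (measurable_locD a) ha.2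
    refine tendsto_lintegral_of_dominated_convergence (fun ζ => 4 * locD ζ a)
      (fun N => measurable_locD _) (fun N => ?_) ?_ ?_
    · filter_upwards [hfin] with ζ hζ
      obtain ⟨β, hβ, hle⟩ := exists_diff_of_seqEnergy_ne_top hζ.ne
      refine (locD_fejer_le (ne_top_of_le_ne_top hζ.ne hle) hβ N).trans ?_
      calc _ ≤ ∑' n, 4 * ENNReal.ofReal (‖β n‖ ^ 2) := by
            refine ENNReal.tsum_le_tsum fun n => ?_
            rw [← ENNReal.ofReal_ofNat 4, ← ENNReal.ofReal_mul (by norm_num)]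
            refine ENNReal.ofReal_le_ofReal (mul_le_mul_of_nonneg_right ?_ (sq_nonneg _))
            linarith [fejer_le_one N n]
        _ = 4 * l2 β := ENNReal.tsum_mul_left
        _ ≤ _ := by gcongr; exact hle
    · rw [lintegral_const_mul _ (measurable_locD a)]
      exact ENNReal.mul_ne_top (by simp) ha.2
    · filter_upwards [hfin] with ζ hζ
      obtain ⟨β, hβ, hle⟩ := exists_diff_of_seqEnergy_ne_top hζ.ne
      have hl := ne_top_of_le_ne_top hζ.ne hle
      exact tendsto_of_tendsto_of_tendsto_of_le_of_le tendsto_const_nhds (tendsto_tsum_fejer hl 4)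
        (fun N => bot_le) fun N => locD_fejer_le hl hβ N
  have hlim := hlim1.add hlim2
  rw [add_zero] at hlim
  obtain ⟨N, hN⟩ := (hlim.eventually (gt_mem_nhds hε)).exists
  refine ⟨∑ n ∈ Finset.range (N + 1), Polynomial.monomial n (a n - m N n), ?_⟩
  convert hN using 1
  rw [coefNormSq]
  have : (fun n => a n - (∑ n ∈ Finset.range (N + 1),
      Polynomial.monomial n (a n - m N n)).coeff n) = m N := by
    ext n
    rw [Polynomial.finsetSum_coeff]
    simp only [Polynomial.coeff_monomial]
    rw [Finset.sum_ite_eq']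
    split_ifs with h
    · ring
    · have hn : N + 1 ≤ n := by simpa using h
      have h1 : fejer N (n - 1) = 1 := min_eq_left (by
        rw [le_div_iff₀ (by positivity)]
        have : (N : ℝ) ≤ (n - 1 : ℕ) := by exact_mod_cast (by omega)
        linarith)
      simp only [hm]
      rw [if_neg (by omega), h1]; simp
  rw [this]

lemma seqEnergy_dilation_le {α : ℕ → ℂ} {r : ℝ} (h0 : 0 ≤ r) (h1 : r ≤ 1) :
    seqEnergy (fun n => α n * r ^ (n + 1)) ≤ 10 * seqEnergy α := by
  rcases eq_or_ne (seqEnergy α) ⊤ with hT | hT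
  · rw [hT]; simp
  obtain ⟨β, hβ, hle⟩ := exists_diff_of_seqEnergy_ne_top hT
  have hl := ne_top_of_le_ne_top hT hle
  have key := seqEnergy_mul_le hl (ρ := fun n => 1 - r ^ (n + 1))
    (fun n => sub_nonneg.2 (pow_le_one₀ h0 h1)) (fun n => sub_le_self _ (by positivity))
    (fun m n h => sub_le_sub_left (pow_le_pow_of_le_one h0 h1 (by omega)) _) (fun n => by
      have h2 : ∀ n : ℕ, ((n : ℝ) + 1) * (r ^ n * (1 - r)) ≤ 1 - r ^ (n + 1) := by
        intro n
        induction n with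
        | zero => simp
        | succ n ih =>
          have h3 : r ^ (n + 1) * (1 - r) ≤ r ^ n * (1 - r) :=
            mul_le_mul_of_nonneg_right (pow_le_pow_of_le_one h0 h1 (Nat.le_succ n)) (by linarith)
          have h4 : ((n : ℝ) + 1) * (r ^ (n + 1) * (1 - r)) ≤ (n + 1) * (r ^ n * (1 - r)) := by
            gcongr
          have h5 : r ^ (n + 1) * (1 - r) = r ^ (n + 1) - r ^ (n + 2) := by ring
          push_cast
          rw [show n + 1 + 1 = n + 2 by ring]
          nlinarith
      have h3 := h2 (n + 1)
      have h4 : 0 ≤ r ^ (n + 1) * (1 - r) := mul_nonneg (by positivity) (by linarith)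
      push_cast at h3
      have h5 : (1 - r ^ (n + 1 + 1) - (1 - r ^ (n + 1))) = r ^ (n + 1) * (1 - r) := by ring
      rw [h5]
      linarith)
  have h2 : ∑' n, ENNReal.ofReal (4 * (1 - r ^ (n + 1)) * ‖β n‖ ^ 2) ≤ 4 * seqEnergy α := by
    calc _ ≤ ∑' n, 4 * ENNReal.ofReal (‖β n‖ ^ 2) := by
          refine ENNReal.tsum_le_tsum fun n => ?_
          rw [← ENNReal.ofReal_ofNat 4, ← ENNReal.ofReal_mul (by norm_num)]
          refine ENNReal.ofReal_le_ofReal (mul_le_mul_of_nonneg_right ?_ (sq_nonneg _))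
          linarith [pow_nonneg h0 (n + 1)]
      _ = 4 * l2 β := ENNReal.tsum_mul_left
      _ ≤ _ := by gcongr
  have h3 : (fun n => α n * (r : ℂ) ^ (n + 1)) = fun n => α n + (-1) *
      (fun n => ((1 - r ^ (n + 1) : ℝ) : ℂ) * (β n - β (n + 1))) n := by
    ext n
    simp only [← hβ]
    push_cast; ring
  rw [h3]
  refine (seqEnergy_add_le _ _).trans ?_
  rw [seqEnergy_const_mul]
  calc _ ≤ 2 * seqEnergy α + 2 * (1 * (4 * seqEnergy α)) := by
        gcongr
        · simp
        · exact key.trans h2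
    _ = _ := by ring

lemma coefNormSq_dilation_le (μ : Measure ℂ) (a : ℕ → ℂ) {r : ℝ} (h0 : 0 ≤ r) (h1 : r ≤ 1) :
    coefNormSq μ (fun n => a n * r ^ n) ≤ 10 * coefNormSq μ a := by
  have hl : l2 (fun n => a n * (r : ℂ) ^ n) ≤ 10 * l2 a := by
    refine le_trans (ENNReal.tsum_le_tsum fun n => ENNReal.ofReal_le_ofReal ?_)
      (le_mul_of_one_le_left' (by norm_num))
    rw [norm_mul, norm_pow, Complex.norm_real, Real.norm_of_nonneg h0]
    gcongr
    exact mul_le_of_le_one_right (norm_nonneg _) (pow_le_one₀ h0 h1)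
  rw [coefNormSq, coefNormSq, mul_add]
  gcongr
  rw [← lintegral_const_mul _ (measurable_locD a)]
  refine lintegral_mono fun ζ => ?_
  simp only [locD, mul_right_comm _ ((r : ℂ) ^ _)]
  exact seqEnergy_dilation_le h0 h1

/-- The squared norm of `D(μ)` with values in `[0, ∞]`, in terms of Taylor coefficients. -/
def dEnergy (μ : Measure ℂ) (f : ℂ → ℂ) : ℝ≥0∞ :=
  coefNormSq μ fun n => (n.factorial : ℂ)⁻¹ * iteratedDeriv n f 0

lemma HasCoef.dEnergy_eq {f : ℂ → ℂ} {a : ℕ → ℂ} (h : HasCoef f a) (μ : Measure ℂ) :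
    dEnergy μ f = coefNormSq μ a := by
  rw [dEnergy, ← funext h.eq_iteratedDeriv]

lemma dEnergy_polynomial (μ : Measure ℂ) (q : Polynomial ℂ) :
    dEnergy μ (fun z => q.eval z) = coefNormSq μ q.coeff := (hasCoef_polynomial q).dEnergy_eq μ

lemma dEnergy_congr (μ : Measure ℂ) {f g : ℂ → ℂ} (hf : DifferentiableOn ℂ f disc)
    (h : ∀ z ∈ disc, f z = g z) : dEnergy μ f = dEnergy μ g := by
  obtain ⟨a, ha⟩ := exists_hasCoef hf
  rw [ha.dEnergy_eq, (ha.congr h).dEnergy_eq]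

lemma dEnergy_add_le (μ : Measure ℂ) {f g : ℂ → ℂ} (hf : DifferentiableOn ℂ f disc)
    (hg : DifferentiableOn ℂ g disc) :
    dEnergy μ (fun z => f z + g z) ≤ 2 * dEnergy μ f + 2 * dEnergy μ g := by
  obtain ⟨a, ha⟩ := exists_hasCoef hf
  obtain ⟨b, hb⟩ := exists_hasCoef hg
  rw [ha.dEnergy_eq, hb.dEnergy_eq, (ha.add hb).dEnergy_eq]
  exact coefNormSq_add_le μ a b

lemma dEnergy_const_mul (μ : Measure ℂ) (c : ℂ) {f : ℂ → ℂ} (hf : DifferentiableOn ℂ f disc) :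
    dEnergy μ (fun z => c * f z) = ENNReal.ofReal (‖c‖ ^ 2) * dEnergy μ f := by
  obtain ⟨a, ha⟩ := exists_hasCoef hf
  rw [ha.dEnergy_eq, (ha.const_mul c).dEnergy_eq, coefNormSq_const_mul]

lemma dEnergy_sub_le (μ : Measure ℂ) {f g : ℂ → ℂ} (hf : DifferentiableOn ℂ f disc)
    (hg : DifferentiableOn ℂ g disc) :
    dEnergy μ (fun z => f z - g z) ≤ 2 * dEnergy μ f + 2 * dEnergy μ g := by
  have := dEnergy_add_le μ hf (hg.const_mul (-1))
  rw [dEnergy_const_mul μ _ hg] at this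
  simpa [sub_eq_add_neg] using this

lemma differentiableOn_eval (q : Polynomial ℂ) : DifferentiableOn ℂ (fun z => q.eval z) disc :=
  q.differentiable.differentiableOn

/-- Polynomials are multipliers of `D(μ)`. -/
lemma exists_dEnergy_eval_mul_le {μ : Measure ℂ} [IsFiniteMeasure μ] (hμ : OnCircle μ)
    (q : Polynomial ℂ) : ∃ C : ℝ≥0∞, C ≠ ⊤ ∧ ∀ f : ℂ → ℂ, DifferentiableOn ℂ f disc →
      dEnergy μ (fun z => q.eval z * f z) ≤ C * dEnergy μ f := by
  induction q using Polynomial.induction_on with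
  | C c =>
    refine ⟨ENNReal.ofReal (‖c‖ ^ 2), ENNReal.ofReal_ne_top, fun f hf => ?_⟩
    simp only [Polynomial.eval_C]
    rw [dEnergy_const_mul μ _ hf]
  | add q r hq hr =>
    obtain ⟨A, hA, hq⟩ := hq
    obtain ⟨B, hB, hr⟩ := hr
    refine ⟨2 * A + 2 * B, by finiteness, fun f hf => ?_⟩
    simp only [Polynomial.eval_add, add_mul]
    refine (dEnergy_add_le μ ((differentiableOn_eval q).mul hf)
      ((differentiableOn_eval r).mul hf)).trans ?_
    rw [mul_assoc, mul_assoc]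
    gcongr
    · exact hq f hf
    · exact hr f hf
  | monomial n c h =>
    obtain ⟨A, hA, h⟩ := h
    refine ⟨(3 + 2 * μ univ) * A, by finiteness, fun f hf => ?_⟩
    have hg : DifferentiableOn ℂ
        (fun z => (Polynomial.C c * Polynomial.X ^ n).eval z * f z) disc :=
      (differentiableOn_eval _).mul hf
    obtain ⟨a, ha⟩ := exists_hasCoef hg
    have h1 : (fun z => (Polynomial.C c * Polynomial.X ^ (n + 1)).eval z * f z) =
        fun z => z * ((Polynomial.C c * Polynomial.X ^ n).eval z * f z) := by
      ext z; simp only [Polynomial.eval_mul, Polynomial.eval_C, Polynomial.eval_pow,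
        Polynomial.eval_X]; ring
    rw [h1, ha.X_mul.dEnergy_eq, mul_assoc]
    refine (coefNormSq_shiftSeq_le hμ a).trans ?_
    gcongr
    rw [← ha.dEnergy_eq]
    exact h f hf

lemma dEnergy_one (μ : Measure ℂ) : dEnergy μ (fun _ => 1) = 1 := by
  have h : HasCoef (fun _ => 1) (fun n => if n = 0 then (1:ℂ) else 0) := fun z _ => by
    convert hasSum_ite_eq 0 (1:ℂ) using 2 with n
    split_ifs with h <;> simp [h]
  rw [h.dEnergy_eq, coefNormSq, l2_eq_zero_add]
  simp [locD, l2, seqEnergy]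

lemma coefNormSq_polynomial_ne_top {μ : Measure ℂ} [IsFiniteMeasure μ] (hμ : OnCircle μ)
    (q : Polynomial ℂ) : coefNormSq μ q.coeff ≠ ⊤ := by
  obtain ⟨C, hC, h⟩ := exists_dEnergy_eval_mul_le hμ q
  have := h (fun _ => 1) (differentiableOn_const 1)
  simp only [mul_one, dEnergy_one] at this
  rw [← dEnergy_polynomial]
  exact ne_top_of_le_ne_top hC this

lemma norm_sq_le_dEnergy (μ : Measure ℂ) {f : ℂ → ℂ} (hf : DifferentiableOn ℂ f disc) {z : ℂ}
    (hz : z ∈ disc) : ENNReal.ofReal (‖f z‖ ^ 2) ≤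
      ENNReal.ofReal ((1 - ‖z‖ ^ 2)⁻¹) * dEnergy μ f := by
  obtain ⟨a, ha⟩ := exists_hasCoef hf
  rw [ha.dEnergy_eq]
  exact (ha.norm_sq_le hz).trans (by gcongr; exact le_self_add)

lemma memD_iff {μ : Measure ℂ} [IsFiniteMeasure μ] (hμ : OnCircle μ) {f : ℂ → ℂ} :
    MemD μ f ↔ DifferentiableOn ℂ f disc ∧ dEnergy μ f ≠ ⊤ := by
  constructor
  · intro h
    obtain ⟨a, ha⟩ := exists_hasCoef h.1.1
    exact ⟨h.1.1, ha.dEnergy_eq μ ▸ (ha.memD_iff hμ).1 h⟩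
  · rintro ⟨hf, h⟩
    obtain ⟨a, ha⟩ := exists_hasCoef hf
    exact (ha.memD_iff hμ).2 (ha.dEnergy_eq μ ▸ h)

lemma MemD.memHardy2 {μ : Measure ℂ} {f : ℂ → ℂ} (h : MemD μ f) : MemHardy2 f := h.1

lemma ofReal_dNormSq {μ : Measure ℂ} [IsFiniteMeasure μ] (hμ : OnCircle μ) {f : ℂ → ℂ}
    (hf : DifferentiableOn ℂ f disc) (h : dEnergy μ f ≠ ⊤) :
    ENNReal.ofReal (dNormSq μ f) = dEnergy μ f := by
  obtain ⟨a, ha⟩ := exists_hasCoef hf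
  rw [ha.dEnergy_eq] at h ⊢
  exact ha.ofReal_dNormSq hμ h

lemma exists_polynomial_dEnergy_lt {μ : Measure ℂ} {f : ℂ → ℂ} (hf : DifferentiableOn ℂ f disc)
    (h : dEnergy μ f ≠ ⊤) {ε : ℝ≥0∞} (hε : 0 < ε) :
    ∃ q : Polynomial ℂ, dEnergy μ (fun z => f z - q.eval z) < ε := by
  obtain ⟨a, ha⟩ := exists_hasCoef hf
  rw [ha.dEnergy_eq] at h
  obtain ⟨q, hq⟩ := exists_polynomial_near h hε
  refine ⟨q, ?_⟩
  have : HasCoef (fun z => f z - q.eval z) (fun n => a n - q.coeff n) := by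
    have := ha.add ((hasCoef_polynomial q).const_mul (-1))
    simpa [sub_eq_add_neg] using this
  rwa [this.dEnergy_eq]

lemma dEnergy_div_le {μ : Measure ℂ} (hμ : OnCircle μ) {g : ℂ → ℂ}
    (hg : DifferentiableOn ℂ g disc) {w : ℂ} (hw : w ∈ disc) :
    dEnergy μ g ≤ ENNReal.ofReal (((1 - ‖w‖)⁻¹) ^ 2) * dEnergy μ (fun z => (z - w) * g z) := by
  obtain ⟨b, hb⟩ := exists_hasCoef hg
  have hd : DifferentiableOn ℂ (fun z => (z - w) * g z) disc :=
    (differentiableOn_id.sub_const w).mul hg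
  obtain ⟨a, ha⟩ := exists_hasCoef hd
  rw [hb.dEnergy_eq, ha.dEnergy_eq]
  exact coefNormSq_div_le hμ hw (coef_of_sub_mul hw hb ha)

/-- Evaluation at `ζ` is bounded on polynomials for the norm of `D(μ)`. -/
def BoundedEval (μ : Measure ℂ) (ζ : ℂ) : Prop :=
  ∃ C : ℝ≥0∞, C ≠ ⊤ ∧ ∀ q : Polynomial ℂ,
    ENNReal.ofReal (‖q.eval ζ‖ ^ 2) ≤ C * dEnergy μ (fun z => q.eval z)

lemma BoundedEval.radial {μ : Measure ℂ} {ζ : ℂ} (hζ : ‖ζ‖ = 1) (h : BoundedEval μ ζ) :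
    ∃ C : ℝ≥0∞, C ≠ ⊤ ∧ ∀ f : ℂ → ℂ, DifferentiableOn ℂ f disc → ∀ r : ℝ, 0 < r → r < 1 →
      ENNReal.ofReal (‖f (r * ζ)‖ ^ 2) ≤ C * dEnergy μ f := by
  obtain ⟨C, hC, h⟩ := h
  have hpoly : ∀ q : Polynomial ℂ, ∀ r : ℝ, 0 < r → r < 1 →
      ENNReal.ofReal (‖q.eval (r * ζ)‖ ^ 2) ≤ C * (10 * dEnergy μ (fun z => q.eval z)) := by
    intro q r h0 h1
    have h2 := h (q.comp (Polynomial.C (r : ℂ) * Polynomial.X))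
    rw [dEnergy_polynomial] at h2
    have h3 : (q.comp (Polynomial.C (r : ℂ) * Polynomial.X)).coeff =
        fun n => q.coeff n * (r : ℂ) ^ n := by
      ext n; exact Polynomial.comp_C_mul_X_coeff
    rw [h3] at h2
    simp only [Polynomial.eval_comp, Polynomial.eval_mul, Polynomial.eval_C,
      Polynomial.eval_X] at h2
    refine h2.trans ?_
    gcongr
    rw [dEnergy_polynomial]
    exact coefNormSq_dilation_le μ _ h0.le h1.le
  refine ⟨1 + 40 * C, by finiteness, fun f hf r h0 h1 => ?_⟩
  rcases eq_or_ne (dEnergy μ f) ⊤ with hT | hT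
  · rw [hT, ENNReal.mul_top (by simp)]; exact le_top
  have hz : (r : ℂ) * ζ ∈ disc := by
    simpa [mem_disc, hζ, abs_of_pos h0] using h1
  set K := ENNReal.ofReal ((1 - ‖(r : ℂ) * ζ‖ ^ 2)⁻¹) with hK
  have key : ∀ ε : ℝ≥0∞, 0 < ε → ENNReal.ofReal (‖f (r * ζ)‖ ^ 2) ≤
      (2 * K + 40 * C) * ε + 40 * C * dEnergy μ f := by
    intro ε hε
    obtain ⟨q, hq⟩ := exists_polynomial_dEnergy_lt hf hT hε
    have hd := hf.sub (differentiableOn_eval q)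
    have h2 : dEnergy μ (fun z => q.eval z) ≤ 2 * dEnergy μ f + 2 * ε := by
      have := dEnergy_sub_le μ hf hd
      simp only [Pi.sub_apply, sub_sub_cancel] at this
      exact this.trans (by gcongr; exact hq.le)
    calc ENNReal.ofReal (‖f (r * ζ)‖ ^ 2)
        = ENNReal.ofReal (‖(f (r * ζ) - q.eval (r * ζ)) + q.eval (r * ζ)‖ ^ 2) := by simp
      _ ≤ 2 * ENNReal.ofReal (‖f (r * ζ) - q.eval (r * ζ)‖ ^ 2) +
          2 * ENNReal.ofReal (‖q.eval (r * ζ)‖ ^ 2) := ofReal_norm_add_sq_le _ _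
      _ ≤ 2 * (K * ε) + 2 * (C * (10 * (2 * dEnergy μ f + 2 * ε))) := by
          gcongr
          · exact (norm_sq_le_dEnergy μ hd hz).trans (by gcongr; exact hq.le)
          · exact (hpoly q r h0 h1).trans (by gcongr)
      _ = _ := by ring
  have hlim : Tendsto (fun ε : ℝ≥0∞ => (2 * K + 40 * C) * ε + 40 * C * dEnergy μ f) (𝓝[>] 0)
      (𝓝 ((2 * K + 40 * C) * 0 + 40 * C * dEnergy μ f)) := by
    refine Tendsto.add ?_ tendsto_const_nhds
    exact ENNReal.Tendsto.const_mul (tendsto_id.mono_left nhdsWithin_le_nhds)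
      (Or.inr (by finiteness))
  have h3 := ge_of_tendsto hlim (eventually_mem_nhdsWithin.mono fun ε hε => key ε hε)
  refine h3.trans ?_
  rw [mul_zero, zero_add]
  gcongr
  exact le_add_self

/-- Taylor coefficients of the holomorphic function with real part the Poisson extension of `u`. -/
def harmCoef (u : ℝ → ℝ) (n : ℕ) : ℂ := (if n = 0 then 1 else 2) * fourierC (fun t => (u t : ℂ)) n

/-- The holomorphic function with real part the Poisson extension of `u`. -/
def harmFun (u : ℝ → ℝ) (z : ℂ) : ℂ := ∑' n, harmCoef u n * z ^ n

lemma intervalIntegrable_of_memLp {u : ℝ → ℂ} (hu : MemLp u 2 θm) :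
    IntervalIntegrable u volume 0 (2 * Real.pi) :=
  (intervalIntegrable_iff_integrableOn_Ioc_of_le Real.two_pi_pos.le).2
    (hu.integrable (by norm_num))

lemma schwarz_kernel (t : ℝ) {z : ℂ} (hz : z ∈ disc) :
    HasSum (fun n : ℕ => (if n = 0 then (1:ℂ) else 2) * Complex.exp (-(n * t * I)) * z ^ n)
      (2 * (1 - Complex.exp (-(t * I)) * z)⁻¹ - 1) := by
  have hn : ‖Complex.exp (-(t * I))‖ ≤ 1 := by
    rw [← neg_mul, ← Complex.ofReal_neg, Complex.norm_exp_ofReal_mul_I]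
  have h1 := (hasCoef_geometric hn z hz).mul_left 2
  have h2 := h1.sub (hasSum_ite_eq 0 (1:ℂ))
  refine hasSum_of_eq h2 fun n => ?_
  simp only [← Complex.exp_nat_mul]
  rcases eq_or_ne n 0 with rfl | h
  · simp; norm_num
  · simp only [h, if_false, sub_zero]
    rw [mul_assoc, mul_neg, mul_assoc]

lemma re_schwarz_kernel (t : ℝ) {z : ℂ} (hz : z ∈ disc) :
    (2 * (1 - Complex.exp (-(t * I)) * z)⁻¹ - 1).re = (1 - ‖z‖ ^ 2) / ‖bpt t - z‖ ^ 2 := by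
  have hb : bpt t ≠ 0 := by simp [bpt]
  have he : Complex.exp (-(t * I)) = (bpt t)⁻¹ := by rw [Complex.exp_neg, bpt, mul_comm]
  have hne : bpt t - z ≠ 0 := fun h => by
    have h1 := norm_bpt t
    rw [sub_eq_zero.1 h] at h1
    exact absurd (mem_disc.1 hz) (by linarith)
  have h1 : 2 * (1 - (bpt t)⁻¹ * z)⁻¹ - 1 = (bpt t + z) / (bpt t - z) := by
    have : 1 - (bpt t)⁻¹ * z = (bpt t - z) / bpt t := by field_simp
    rw [this, inv_div]; field_simp; ring
  have hsq : (bpt t).re ^ 2 + (bpt t).im ^ 2 = 1 := by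
    have := norm_bpt t
    rw [← one_pow 2, ← this, ← Complex.normSq_eq_norm_sq, Complex.normSq_apply]; ring
  rw [he, h1, Complex.div_re, ← Complex.normSq_eq_norm_sq, ← Complex.normSq_eq_norm_sq, ← add_div]
  congr 1
  rw [Complex.normSq_apply]
  simp only [Complex.add_re, Complex.sub_re, Complex.add_im, Complex.sub_im]
  nlinarith

lemma hasSum_harmFun {u : ℝ → ℝ} (hu : MemLp (fun t => (u t : ℂ)) 2 θm) {z : ℂ} (hz : z ∈ disc) :
    HasSum (fun n => harmCoef u n * z ^ n) (((1 / (2 * Real.pi) : ℝ) : ℂ) *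
      ∫ t in (0:ℝ)..(2 * Real.pi), (2 * (1 - Complex.exp (-(t * I)) * z)⁻¹ - 1) * u t) := by
  have hi := intervalIntegrable_of_memLp hu
  have hz1 := mem_disc.1 hz
  have key : HasSum (fun n : ℕ => ∫ t in (0:ℝ)..(2 * Real.pi),
      (if n = 0 then (1:ℂ) else 2) * Complex.exp (-(n * t * I)) * z ^ n * u t)
      (∫ t in (0:ℝ)..(2 * Real.pi), (2 * (1 - Complex.exp (-(t * I)) * z)⁻¹ - 1) * u t) := by
    refine intervalIntegral.hasSum_integral_of_dominated_convergence
      (fun n t => 2 * ‖z‖ ^ n * ‖(u t : ℂ)‖) (fun n => ?_) (fun n => ?_) ?_ ?_ ?_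
    · refine AEStronglyMeasurable.mul (Continuous.aestronglyMeasurable (by fun_prop)) ?_
      rw [uIoc_of_le Real.two_pi_pos.le]
      exact hu.aestronglyMeasurable
    · refine Eventually.of_forall fun t _ => ?_
      rw [norm_mul, norm_mul, norm_mul, norm_pow]
      have h1 : ‖Complex.exp (-(n * t * I))‖ = 1 := by
        rw [← neg_mul, ← Complex.ofReal_natCast, ← Complex.ofReal_mul, ← Complex.ofReal_neg,
          Complex.norm_exp_ofReal_mul_I]
      have h2 : ‖(if n = 0 then (1:ℂ) else 2)‖ ≤ 2 := by split_ifs <;> simp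
      rw [h1, mul_one]
      gcongr
    · exact Eventually.of_forall fun t _ =>
        ((summable_geometric_of_lt_one (norm_nonneg z) hz1).mul_left 2).mul_right _
    · simp only [tsum_mul_right]
      exact hi.norm.const_mul _
    · exact Eventually.of_forall fun t _ => (schwarz_kernel t hz).mul_right _
  refine hasSum_of_eq (key.mul_left _) fun n => ?_
  rw [harmCoef, fourierC]
  have : ∀ t : ℝ, (if n = 0 then (1:ℂ) else 2) * Complex.exp (-(n * t * I)) * z ^ n * u t =
      ((if n = 0 then (1:ℂ) else 2) * z ^ n) * (Complex.exp (-(n * t * I)) * u t) :=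
    fun t => by ring
  simp only [this]
  rw [intervalIntegral.integral_const_mul]
  push_cast
  ring

lemma hasCoef_harmFun {u : ℝ → ℝ} (hu : MemLp (fun t => (u t : ℂ)) 2 θm) :
    HasCoef (harmFun u) (harmCoef u) := fun _ hz => (hasSum_harmFun hu hz).summable.hasSum

lemma poissonExt_eq_re {u : ℝ → ℝ} (hu : MemLp (fun t => (u t : ℂ)) 2 θm) {z : ℂ} (hz : z ∈ disc) :
    poissonExt u z = (harmFun u z).re := by
  have hi := intervalIntegrable_of_memLp hu
  have hc : Continuous fun t : ℝ => (2 * (1 - Complex.exp (-(t * I)) * z)⁻¹ - 1) := by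
    refine Continuous.sub (continuous_const.mul (Continuous.inv₀ (by fun_prop) fun t h => ?_))
      continuous_const
    have h1 : ‖Complex.exp (-(t * I)) * z‖ = ‖z‖ := by
      rw [norm_mul, ← neg_mul, ← Complex.ofReal_neg, Complex.norm_exp_ofReal_mul_I, one_mul]
    rw [← sub_eq_zero.1 h] at h1
    have := mem_disc.1 hz
    simp at h1
    linarith
  rw [harmFun, (hasSum_harmFun hu hz).tsum_eq, Complex.re_ofReal_mul, poissonExt]
  congr 1
  have h2 := Complex.reCLM.intervalIntegral_comp_comm
    (hi.continuousOn_mul hc.continuousOn)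
  simp only [Complex.reCLM_apply] at h2
  rw [← h2]
  refine intervalIntegral.integral_congr fun t _ => ?_
  rw [Complex.re_mul_ofReal, re_schwarz_kernel t hz]

lemma norm_reCLM_comp (d : ℂ) :
    ‖Complex.reCLM.comp ((ContinuousLinearMap.toSpanSingleton ℂ d).restrictScalars ℝ)‖ = ‖d‖ := by
  set L := Complex.reCLM.comp ((ContinuousLinearMap.toSpanSingleton ℂ d).restrictScalars ℝ)
  have hL : ∀ v, L v = (v * d).re := fun v => rfl
  refine le_antisymm (L.opNorm_le_bound (norm_nonneg d) fun v => ?_) ?_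
  · rw [hL, Real.norm_eq_abs]
    exact (Complex.abs_re_le_norm _).trans (by rw [norm_mul, mul_comm])
  · rcases eq_or_ne d 0 with h | h
    · rw [h, norm_zero]; exact norm_nonneg L
    have h1 := L.le_opNorm ((starRingEnd ℂ) d)
    rw [hL, mul_comm, Complex.mul_conj, Complex.ofReal_re, Complex.normSq_eq_norm_sq,
      RCLike.norm_conj, Real.norm_of_nonneg (sq_nonneg _), sq] at h1
    exact le_of_mul_le_mul_right h1 (norm_pos_iff.2 h)

lemma gradDensity_eq {u : ℝ → ℝ} (hu : MemLp (fun t => (u t : ℂ)) 2 θm) (μ : Measure ℂ) {z : ℂ}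
    (hz : z ∈ disc) : gradDensity μ u z = dirichletDensity μ (harmFun u) z := by
  have hd := ((hasCoef_harmFun hu).differentiableOn.differentiableAt
    (isOpen_disc.mem_nhds hz)).hasDerivAt
  have h1 : HasFDerivAt (fun z => (harmFun u z).re) (Complex.reCLM.comp
      ((ContinuousLinearMap.toSpanSingleton ℂ (deriv (harmFun u) z)).restrictScalars ℝ)) z :=
    Complex.reCLM.hasFDerivAt.comp z (hd.hasFDerivAt.restrictScalars ℝ)
  have h2 : poissonExt u =ᶠ[𝓝 z] fun z => (harmFun u z).re :=
    (isOpen_disc.mem_nhds hz |> eventually_of_mem) fun w hw => poissonExt_eq_re hu hw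
  rw [gradDensity, dirichletDensity, h2.fderiv_eq, h1.fderiv, norm_reCLM_comp]

lemma memLp_two_ofReal {u : ℝ → ℝ} (hu : MemLp u 2 θm) : MemLp (fun t => (u t : ℂ)) 2 θm :=
  hu.ofReal

lemma memDh_iff {μ : Measure ℂ} [IsFiniteMeasure μ] (hμ : OnCircle μ) {u : ℝ → ℝ}
    (hu : MemLp u 2 θm) : MemDh μ u ↔ ∫⁻ ζ, locD ζ (harmCoef u) ∂μ ≠ ⊤ := by
  have hu' := memLp_two_ofReal hu
  rw [MemDh, integrableOn_congr_fun (fun z hz => gradDensity_eq hu' μ hz) measurableSet_disc,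
    (hasCoef_harmFun hu').integrableOn_dirichletDensity_iff hμ]
  exact and_iff_right hu.integrable_sq

lemma ofReal_dhNormSq {μ : Measure ℂ} [IsFiniteMeasure μ] (hμ : OnCircle μ) {u : ℝ → ℝ}
    (hu : MemLp u 2 θm) (h : ∫⁻ ζ, locD ζ (harmCoef u) ∂μ ≠ ⊤) :
    ENNReal.ofReal (dhNormSq μ u) =
      ENNReal.ofReal ((1 / (2 * Real.pi)) * ∫ t in (0:ℝ)..(2 * Real.pi), (u t) ^ 2) +
        ∫⁻ ζ, locD ζ (harmCoef u) ∂μ := by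
  have hu' := memLp_two_ofReal hu
  have h1 : dhNormSq μ u = (1 / (2 * Real.pi)) * (∫ t in (0:ℝ)..(2 * Real.pi), (u t) ^ 2) +
      dirichletIntegral μ (harmFun u) := by
    rw [dhNormSq, dirichletIntegral, intervalIntegral.integral_of_le Real.two_pi_pos.le,
      setIntegral_congr_fun measurableSet_disc fun z hz => gradDensity_eq hu' μ hz]
  rw [h1, (hasCoef_harmFun hu').dirichletIntegral_eq hμ, ENNReal.ofReal_add _ ENNReal.toReal_nonneg,
    ENNReal.ofReal_toReal h]
  refine mul_nonneg (by positivity) (intervalIntegral.integral_nonneg Real.two_pi_pos.le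
    fun t _ => sq_nonneg _)

lemma l2_fourierC_le {u : ℝ → ℂ} (hu : MemLp u 2 θm) : l2 (fun n : ℕ => fourierC u n) ≤
    ENNReal.ofReal ((1 / (2 * Real.pi)) * ∫ t in (0:ℝ)..(2 * Real.pi), ‖u t‖ ^ 2) := by
  have h := hasSum_sq_fourierC hu
  rw [← h.tsum_eq, ENNReal.ofReal_tsum_of_nonneg (fun _ => sq_nonneg _) h.summable]
  exact ENNReal.tsum_comp_le_tsum_of_injective Nat.cast_injective
    (fun n : ℤ => ENNReal.ofReal (‖fourierC u n‖ ^ 2))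

lemma dEnergy_harmFun_le {μ : Measure ℂ} [IsFiniteMeasure μ] (hμ : OnCircle μ) {u : ℝ → ℝ}
    (hu : MemLp u 2 θm) (h : MemDh μ u) :
    dEnergy μ (harmFun u) ≤ 4 * ENNReal.ofReal (dhNormSq μ u) := by
  have hu' := memLp_two_ofReal hu
  rw [(hasCoef_harmFun hu').dEnergy_eq, ofReal_dhNormSq hμ hu ((memDh_iff hμ hu).1 h), coefNormSq,
    mul_add]
  gcongr
  · have h1 := l2_fourierC_le hu'
    simp only [Complex.norm_real, Real.norm_eq_abs, sq_abs] at h1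
    refine le_trans ?_ (mul_le_mul_right h1 4)
    rw [l2, l2, ← ENNReal.tsum_mul_left]
    refine ENNReal.tsum_le_tsum fun n => ?_
    rw [← ENNReal.ofReal_ofNat 4, ← ENNReal.ofReal_mul (by norm_num), harmCoef, norm_mul, mul_pow]
    refine ENNReal.ofReal_le_ofReal (mul_le_mul_of_nonneg_right ?_ (sq_nonneg _))
    split_ifs <;> norm_num
  · exact le_mul_of_one_le_left' (by norm_num)

lemma harmFun_one (z : ℂ) : harmFun (fun _ => 1) z = 1 := by
  have h : ∀ n, harmCoef (fun _ => 1) n * z ^ n = if n = 0 then 1 else 0 := by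
    intro n
    have h1 := integral_exp_int (-(n : ℤ))
    have h2 : ∀ t : ℝ, Complex.exp (((-(n : ℤ) : ℤ) : ℂ) * t * I) =
        Complex.exp (-(((n : ℤ) : ℂ) * t * I)) := fun t => by push_cast; ring_nf
    simp only [h2] at h1
    rw [harmCoef, fourierC]
    simp only [Complex.ofReal_one, mul_one]
    rw [h1]
    rcases eq_or_ne n 0 with rfl | hn
    · have : (Real.pi : ℂ) ≠ 0 := by exact_mod_cast Real.pi_ne_zero
      simp
      field_simp
    · simp [hn]
  rw [harmFun, tsum_congr h, tsum_ite_eq]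

lemma memLp_of_memDh {μ : Measure ℂ} {u : ℝ → ℝ} (h : MemDh μ u) (h0 : ∀ t, 0 ≤ u t) :
    MemLp u 2 θm := by
  have h1 : Integrable (fun t => u t ^ 2) θm := h.1
  refine (memLp_two_iff_integrable_sq ?_).2 h1
  have h2 : u = fun t => Real.sqrt (u t ^ 2) := funext fun t => (Real.sqrt_sq (h0 t)).symm
  rw [h2]
  exact Real.continuous_sqrt.comp_aestronglyMeasurable h1.aestronglyMeasurable

lemma le_poissonExt {u : ℝ → ℝ} (hu : MemLp u 2 θm) (h0 : ∀ t, 0 ≤ u t) {ζ : ℂ} (hζ : ‖ζ‖ = 1)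
    {δ : ℝ} (hδ : 0 < δ) (hu1 : ∀ᵐ t ∂θm, ‖bpt t - ζ‖ < δ → 1 ≤ u t) {r : ℝ} (hr : 0 < r)
    (hr1 : r < 1) (hrδ : 1 - r ≤ δ / 2) :
    1 - (1 - r ^ 2) / (δ / 2) ^ 2 ≤ poissonExt u (r * ζ) := by
  have hz : (r : ℂ) * ζ ∈ disc := by simpa [mem_disc, hζ, abs_of_pos hr] using hr1
  have hnz : ‖(r : ℂ) * ζ‖ = r := by simp [hζ, abs_of_pos hr]
  have hu' := memLp_two_ofReal hu
  set P : ℝ → ℝ := fun t => (1 - ‖(r : ℂ) * ζ‖ ^ 2) / ‖bpt t - r * ζ‖ ^ 2 with hP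
  have hden : ∀ t, ‖bpt t - r * ζ‖ ≠ 0 := fun t h => by
    have := norm_bpt t
    rw [sub_eq_zero.1 (norm_eq_zero.1 h), hnz] at this
    linarith
  have hPc : Continuous P := by
    refine continuous_const.div ?_ fun t => pow_ne_zero 2 (hden t)
    have := continuous_bpt
    fun_prop
  have hr2 : 0 ≤ 1 - r ^ 2 := by nlinarith
  have hP0 : ∀ t, 0 ≤ P t := fun t => by simp only [hP, hnz]; positivity
  have hone : (1 / (2 * Real.pi)) * ∫ t in (0:ℝ)..(2 * Real.pi), P t = 1 := by
    have h1 := poissonExt_eq_re (u := fun _ => 1) (memLp_of_continuous continuous_const) hz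
    rw [harmFun_one, poissonExt] at h1
    simpa [hP] using h1
  have hui : IntervalIntegrable u volume 0 (2 * Real.pi) :=
    (intervalIntegrable_iff_integrableOn_Ioc_of_le Real.two_pi_pos.le).2
      (hu.integrable (by norm_num))
  have hPi : IntervalIntegrable P volume 0 (2 * Real.pi) := hPc.intervalIntegrable _ _
  have hmono : ∫ t in (0:ℝ)..(2 * Real.pi), (P t - (1 - r ^ 2) / (δ / 2) ^ 2) ≤
      ∫ t in (0:ℝ)..(2 * Real.pi), P t * u t := by
    rw [intervalIntegral.integral_of_le Real.two_pi_pos.le,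
      intervalIntegral.integral_of_le Real.two_pi_pos.le]
    refine integral_mono_ae (hPi.sub intervalIntegrable_const).1
      (hui.continuousOn_mul hPc.continuousOn).1 ?_
    filter_upwards [hu1] with t ht
    by_cases hb : ‖bpt t - ζ‖ < δ
    · have h1 : P t ≤ P t * u t := le_mul_of_one_le_right (hP0 t) (ht hb)
      have h2 : 0 ≤ (1 - r ^ 2) / (δ / 2) ^ 2 := by positivity
      linarith
    · have h1 : δ / 2 ≤ ‖bpt t - r * ζ‖ := by
        have h2 := norm_sub_norm_le (bpt t - ζ) (r * ζ - ζ)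
        have h3 : ‖(r : ℂ) * ζ - ζ‖ = 1 - r := by
          rw [← sub_one_mul, norm_mul, hζ, mul_one, ← Complex.ofReal_one, ← Complex.ofReal_sub,
            Complex.norm_real, Real.norm_eq_abs, abs_sub_comm, abs_of_pos (by linarith)]
        rw [sub_sub_sub_cancel_right] at h2
        linarith [not_lt.1 hb]
      have h2 : P t ≤ (1 - r ^ 2) / (δ / 2) ^ 2 := by
        simp only [hP, hnz]
        gcongr
      have h3 := mul_nonneg (hP0 t) (h0 t)
      linarith
  rw [intervalIntegral.integral_sub hPi intervalIntegrable_const,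
    intervalIntegral.integral_const] at hmono
  rw [poissonExt]
  calc _ = (1 / (2 * Real.pi)) * ((∫ t in (0:ℝ)..(2 * Real.pi), P t) -
        (2 * Real.pi - 0) • ((1 - r ^ 2) / (δ / 2) ^ 2)) := by
        rw [mul_sub, hone, smul_eq_mul, sub_zero, ← mul_assoc,
          one_div_mul_cancel Real.two_pi_pos.ne', one_mul]
    _ ≤ _ := mul_le_mul_of_nonneg_left hmono (by positivity)

lemma BoundedEval.cap_pos {μ : Measure ℂ} [IsFiniteMeasure μ] (hμ : OnCircle μ) {ζ : ℂ}
    (hζ : ‖ζ‖ = 1) (h : BoundedEval μ ζ) : 0 < cap μ {ζ} := by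
  obtain ⟨C, hC, h⟩ := h.radial hζ
  refine pos_of_ne_zero fun hcap => ?_
  set ε : ℝ≥0∞ := (32 * (C + 1))⁻¹ with hε
  have hε0 : 0 < ε := ENNReal.inv_pos.2 (by finiteness)
  have h1 : cap μ {ζ} < ε := hcap ▸ hε0
  simp only [cap, capOpen, iInf_lt_iff] at h1
  obtain ⟨U, ⟨⟨V, hV, rfl⟩, hζU⟩, u, ⟨hu, h0, hu1⟩, hlt⟩ := h1
  have hL := memLp_of_memDh hu h0
  have hE := (dEnergy_harmFun_le hμ hL hu).trans (mul_le_mul_right hlt.le 4)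
  obtain ⟨δ, hδ, hball⟩ := Metric.isOpen_iff.1 hV ζ (hζU rfl).1
  have hu2 : ∀ᵐ t ∂θm, ‖bpt t - ζ‖ < δ → 1 ≤ u t := hu1.mono fun t ht hb =>
    ht ⟨hball (by rwa [mem_ball, dist_eq_norm]), mem_circleT.2 (norm_bpt t)⟩
  have hlim : Tendsto (fun r : ℝ => 1 - (1 - r ^ 2) / (δ / 2) ^ 2) (𝓝[<] 1) (𝓝 1) := by
    have : Continuous fun r : ℝ => 1 - (1 - r ^ 2) / (δ / 2) ^ 2 := by fun_prop
    have h2 := this.tendsto 1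
    simp only [one_pow, sub_self, zero_div, sub_zero] at h2
    exact h2.mono_left nhdsWithin_le_nhds
  have hev := hlim.eventually (lt_mem_nhds (show (1/2 : ℝ) < 1 by norm_num))
  have hev2 : ∀ᶠ r : ℝ in 𝓝[<] 1, r ∈ Ioo (max 0 (1 - δ / 2)) 1 :=
    Ioo_mem_nhdsLT (by rw [max_lt_iff]; constructor <;> linarith)
  obtain ⟨r, hr, hr1, hr2⟩ := (hev.and hev2).exists
  rw [max_lt_iff] at hr1
  have h2 := le_poissonExt hL h0 hζ hδ hu2 hr1.1 hr2 (by linarith)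
  have hz : (r : ℂ) * ζ ∈ disc := by simpa [mem_disc, hζ, abs_of_pos hr1.1] using hr2
  rw [poissonExt_eq_re (memLp_two_ofReal hL) hz] at h2
  have h3 : (1/2 : ℝ) ≤ ‖harmFun u (r * ζ)‖ := (hr.le.trans h2).trans (Complex.re_le_norm _)
  have h4 := (h (harmFun u) (hasCoef_harmFun (memLp_two_ofReal hL)).differentiableOn r hr1.1
    hr2).trans (mul_le_mul_right hE C)
  have h5 : ENNReal.ofReal (1/4) ≤ C * (4 * ε) :=
    (ENNReal.ofReal_le_ofReal (by nlinarith)).trans h4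
  have h6 : C * (4 * ε) ≤ 4 * (C + 1) * ε := by
    calc _ = 4 * C * ε := by ring
      _ ≤ _ := by gcongr; exact le_self_add
  have h7 : 4 * (C + 1) * ε = 8⁻¹ := by
    rw [hε, ENNReal.mul_inv (by simp) (by simp), mul_mul_mul_comm,
      ENNReal.mul_inv_cancel (by simp) (by finiteness), mul_one]
    rw [show (32 : ℝ≥0∞) = 4 * 8 by norm_num, ENNReal.mul_inv (by simp) (by simp), ← mul_assoc,
      ENNReal.mul_inv_cancel (by simp) (by simp), one_mul]
  have h8 := h5.trans (h6.trans_eq h7)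
  have h9 : (8⁻¹ : ℝ≥0∞) = ENNReal.ofReal (1/8) := by
    rw [one_div, ENNReal.ofReal_inv_of_pos (by norm_num)]; simp
  rw [h9, ENNReal.ofReal_le_ofReal_iff (by norm_num)] at h8
  norm_num at h8

lemma exists_normalized_of_not_boundedEval {μ : Measure ℂ} {ζ : ℂ} (h : ¬ BoundedEval μ ζ)
    {ε : ℝ≥0∞} (hε : 0 < ε) (hε' : ε ≠ ⊤) :
    ∃ q : Polynomial ℂ, q.eval ζ = 1 ∧ dEnergy μ (fun z => q.eval z) < ε := by
  by_contra hcon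
  push Not at hcon
  refine h ⟨ε⁻¹, ENNReal.inv_ne_top.2 hε.ne', fun q => ?_⟩
  rcases eq_or_ne (q.eval ζ) 0 with h0 | h0
  · simp [h0]
  have h1 := hcon (Polynomial.C (q.eval ζ)⁻¹ * q) (by simp [h0])
  simp only [Polynomial.eval_mul, Polynomial.eval_C] at h1
  rw [dEnergy_const_mul μ _ (differentiableOn_eval q)] at h1
  have hpos : 0 < ‖q.eval ζ‖ ^ 2 := by positivity
  rw [norm_inv, inv_pow, ENNReal.ofReal_inv_of_pos hpos] at h1
  have hx0 : ENNReal.ofReal (‖q.eval ζ‖ ^ 2) ≠ 0 := by simpa using h0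
  rw [mul_comm ε⁻¹, ← div_eq_mul_inv, ENNReal.le_div_iff_mul_le (Or.inl hε.ne') (Or.inl hε')]
  calc _ ≤ _ := mul_le_mul_right h1 _
    _ = _ := by rw [← mul_assoc, ENNReal.mul_inv_cancel hx0 ENNReal.ofReal_ne_top, one_mul]

lemma hasSum_sq_coeff (q : Polynomial ℂ) : HasSum (fun n => ‖q.coeff n‖ ^ 2)
    (1 / (2 * Real.pi) * ∫ t in (0:ℝ)..(2 * Real.pi), ‖q.eval (bpt t)‖ ^ 2) := by
  have h := (hasCoef_polynomial (q.comp (Polynomial.C 2 * Polynomial.X))).hasSum_circle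
    (r := 1 / 2) (by norm_num) (by norm_num)
  have h1 : ∀ n, ‖(q.comp (Polynomial.C 2 * Polynomial.X)).coeff n‖ ^ 2 * (1 / 2 : ℝ) ^ (2 * n) =
      ‖q.coeff n‖ ^ 2 := fun n => by
    rw [Polynomial.comp_C_mul_X_coeff, norm_mul, norm_pow, mul_pow, pow_mul, ← pow_mul,
      mul_comm n 2, pow_mul, mul_assoc, ← mul_pow]
    norm_num
  simp only [h1] at h
  convert h using 6 with t
  simp

lemma l2_coeff_eq (q : Polynomial ℂ) : l2 q.coeff =
    ENNReal.ofReal (1 / (2 * Real.pi) * ∫ t in (0:ℝ)..(2 * Real.pi), ‖q.eval (bpt t)‖ ^ 2) := by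
  have h := hasSum_sq_coeff q
  rw [← h.tsum_eq, ENNReal.ofReal_tsum_of_nonneg (fun _ => sq_nonneg _) h.summable, l2]

/-- The local Dirichlet integral of a polynomial dominates the norm of its difference quotient. -/
lemma l2_le_locD {q G : Polynomial ℂ} {l : ℂ} (hl : ‖l‖ = 1)
    (hG : q = Polynomial.C (q.eval l) + (Polynomial.X - Polynomial.C l) * G) :
    l2 G.coeff ≤ locD l q.coeff := by
  rcases eq_or_ne (locD l q.coeff) ⊤ with hT | hT
  · rw [hT]; exact le_top
  obtain ⟨β, hβ, hle⟩ := exists_diff_of_seqEnergy_ne_top hT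
  have hq : ∀ n, q.coeff (n + 1) = G.coeff n - l * G.coeff (n + 1) := fun n => by
    conv_lhs => rw [hG]
    simp [sub_mul, Polynomial.coeff_X_mul]
  set γ : ℕ → ℂ := fun n => l ^ (n + 1) * G.coeff n with hγ
  have hd : ∀ n, β n - γ n = β 0 - γ 0 := by
    intro n
    induction n with
    | zero => rfl
    | succ n ih =>
      rw [← ih]
      have h1 := hβ n
      rw [hq] at h1
      simp only [hγ]
      rw [pow_succ l (n + 1)]
      linear_combination h1
  have hβ0 : Tendsto β atTop (𝓝 0) := by
    have h1 := (summable_of_l2_ne_top (ne_top_of_le_ne_top hT hle)).tendsto_atTop_zero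
    have h2 := h1.sqrt
    simp only [Real.sqrt_sq (norm_nonneg _), Real.sqrt_zero] at h2
    exact tendsto_zero_iff_norm_tendsto_zero.2 h2
  have hγ0 : Tendsto γ atTop (𝓝 0) := by
    refine tendsto_const_nhds.congr' ?_
    filter_upwards [eventually_gt_atTop G.natDegree] with n hn
    simp [hγ, Polynomial.coeff_eq_zero_of_natDegree_lt hn]
  have h0 := hβ0.sub hγ0
  simp only [hd, sub_zero] at h0
  have h1 := tendsto_nhds_unique tendsto_const_nhds h0
  have h2 : ∀ n, β n = γ n := fun n => sub_eq_zero.1 ((hd n).trans h1)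
  rw [l2_congr_norm (x := G.coeff) (y := β) fun n => by rw [h2]; simp [hγ, hl]]
  exact hle

lemma fourierC_bpt_mul (φ : ℝ → ℂ) (n : ℕ) :
    fourierC (fun t => bpt t * φ t) ((n : ℤ) + 1) = fourierC φ n := by
  rw [fourierC, fourierC]
  congr 2; ext t
  rw [← mul_assoc, bpt, ← Complex.exp_add]
  congr 2
  push_cast; ring

lemma fourierC_const_succ (c : ℂ) (n : ℕ) : fourierC (fun _ => c) ((n : ℤ) + 1) = 0 := by
  have h1 := integral_exp_int (-((n : ℤ) + 1))
  rw [if_neg (by omega)] at h1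
  have h2 : ∀ t : ℝ, Complex.exp (((-((n : ℤ) + 1) : ℤ) : ℂ) * t * I) =
      Complex.exp (-((((n : ℤ) + 1 : ℤ) : ℂ) * t * I)) := fun t => by push_cast; ring_nf
  simp only [h2] at h1
  rw [fourierC, intervalIntegral.integral_mul_const, h1]; simp

lemma fourierC_add {u v : ℝ → ℂ} (hu : MemLp u 2 θm) (hv : MemLp v 2 θm) (n : ℤ) :
    fourierC (fun t => u t + v t) n = fourierC u n + fourierC v n := by
  have he : ContinuousOn (fun t : ℝ => Complex.exp (-(n * t * I))) (uIcc 0 (2 * Real.pi)) := by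
    fun_prop
  simp only [fourierC, mul_add]
  rw [intervalIntegral.integral_add ((intervalIntegrable_of_memLp hu).continuousOn_mul he)
    ((intervalIntegrable_of_memLp hv).continuousOn_mul he), mul_add]

lemma fourierC_const_mul (c : ℂ) (u : ℝ → ℂ) (n : ℤ) :
    fourierC (fun t => c * u t) n = c * fourierC u n := by
  simp only [fourierC, mul_left_comm _ c]
  rw [intervalIntegral.integral_const_mul]; ring

/-- The map `q ↦ 2|q|` is bounded for the local Dirichlet integrals. -/
lemma locD_harmCoef_le (q : Polynomial ℂ) {l : ℂ} (hl : ‖l‖ = 1) :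
    locD l (harmCoef fun t => 2 * ‖q.eval (bpt t)‖) ≤ 16 * locD l q.coeff := by
  obtain ⟨G, hG⟩ := Polynomial.X_sub_C_dvd_sub_C_eval (p := q) (a := l)
  have hG' : q = Polynomial.C (q.eval l) + (Polynomial.X - Polynomial.C l) * G := by
    rw [← hG]; ring
  set u : ℝ → ℝ := fun t => 2 * ‖q.eval (bpt t)‖ with hu
  set φ : ℝ → ℂ := fun t => ((u t : ℂ) - (2 * ‖q.eval l‖ : ℝ)) / (bpt t - l) with hφ
  have hbc := continuous_bpt
  have huc : Continuous u := by
    have := q.continuous.comp hbc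
    exact continuous_const.mul this.norm
  have hid : ∀ t, (u t : ℂ) = (2 * ‖q.eval l‖ : ℝ) + (bpt t * φ t + (-l) * φ t) := by
    intro t
    rcases eq_or_ne (bpt t - l) 0 with h | h
    · rw [sub_eq_zero] at h
      simp only [hu, h]; ring
    · have : (bpt t - l) * φ t = (u t : ℂ) - (2 * ‖q.eval l‖ : ℝ) := mul_div_cancel₀ _ h
      linear_combination -this
  have hφG : ∀ t, ‖φ t‖ ≤ 2 * ‖G.eval (bpt t)‖ := by
    intro t
    rcases eq_or_ne (bpt t - l) 0 with h | h
    · simp only [hφ, h, div_zero, norm_zero]; positivity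
    · have h1 : q.eval (bpt t) - q.eval l = (bpt t - l) * G.eval (bpt t) := by
        have := congrArg (Polynomial.eval (bpt t)) hG
        simpa using this
      rw [hφ]
      simp only
      rw [norm_div, div_le_iff₀ (norm_pos_iff.2 h), ← Complex.ofReal_sub, Complex.norm_real,
        hu]
      simp only
      rw [← mul_sub, norm_mul, mul_assoc, mul_comm ‖G.eval _‖, ← norm_mul (bpt t - l), ← h1]
      have := abs_norm_sub_norm_le (q.eval (bpt t)) (q.eval l)
      rw [Real.norm_eq_abs, Real.norm_eq_abs, abs_two]
      linarith
  have hGL : MemLp (fun t => G.eval (bpt t)) 2 θm := memLp_of_continuous (G.continuous.comp hbc)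
  have hφm : AEStronglyMeasurable φ θm := by
    refine Measurable.aestronglyMeasurable (Measurable.div ?_ ?_)
    · exact (Complex.continuous_ofReal.comp huc).measurable.sub_const _
    · exact hbc.measurable.sub_const _
  have hφL : MemLp φ 2 θm := MemLp.of_le_mul hGL hφm (Eventually.of_forall hφG)
  have hbφ : MemLp (fun t => bpt t * φ t) 2 θm :=
    hφL.of_le (hbc.aestronglyMeasurable.mul hφm)
      (Eventually.of_forall fun t => by rw [norm_mul, norm_bpt, one_mul])
  have hcoef : ∀ n : ℕ, fourierC (fun t => (u t : ℂ)) ((n + 1 : ℕ) : ℤ) =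
      fourierC φ n - l * fourierC φ ((n + 1 : ℕ) : ℤ) := by
    intro n
    have hs : MemLp (fun t => bpt t * φ t + (-l) * φ t) 2 θm := hbφ.add (hφL.const_mul (-l))
    simp only [hid]
    rw [fourierC_add (memLp_of_continuous continuous_const) hs,
      fourierC_add hbφ (hφL.const_mul (-l)), fourierC_const_mul]
    push_cast
    rw [fourierC_bpt_mul, fourierC_const_succ]
    ring
  set b : ℕ → ℂ := fun n => 2 * (l ^ (n + 1) * fourierC φ n) with hb
  have hd : (fun n => harmCoef u (n + 1) * l ^ (n + 1)) = fun n => b n - b (n + 1) := by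
    ext n
    rw [harmCoef, if_neg (Nat.succ_ne_zero n), hcoef]
    simp only [hb]
    ring
  rw [locD, hd]
  have hint : (1 / (2 * Real.pi)) * ∫ t in (0:ℝ)..(2 * Real.pi), ‖φ t‖ ^ 2 ≤
      4 * (1 / (2 * Real.pi) * ∫ t in (0:ℝ)..(2 * Real.pi), ‖G.eval (bpt t)‖ ^ 2) := by
    rw [mul_left_comm]
    refine mul_le_mul_of_nonneg_left ?_ (by positivity)
    rw [← intervalIntegral.integral_const_mul]
    refine intervalIntegral.integral_mono_on Real.two_pi_pos.le ?_ ?_ fun t _ => ?_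
    · exact (intervalIntegrable_iff_integrableOn_Ioc_of_le Real.two_pi_pos.le).2
        (hφL.integrable_norm_pow two_ne_zero)
    · exact Continuous.intervalIntegrable
        (continuous_const.mul ((G.continuous.comp hbc).norm.pow 2)) _ _
    · nlinarith [hφG t, norm_nonneg (φ t)]
  calc _ ≤ l2 b := seqEnergy_diff_le b
    _ = 4 * l2 (fun n : ℕ => fourierC φ n) := by
        rw [hb, l2_const_mul 2 (fun n : ℕ => l ^ (n + 1) * fourierC φ n),
          l2_congr_norm (y := fun n : ℕ => fourierC φ n) fun n => by simp [hl]]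
        norm_num
    _ ≤ 4 * (4 * l2 G.coeff) := by
        gcongr
        refine (l2_fourierC_le hφL).trans ((ENNReal.ofReal_le_ofReal hint).trans_eq ?_)
        rw [ENNReal.ofReal_mul (by norm_num), l2_coeff_eq]; simp
    _ = 16 * l2 G.coeff := by ring
    _ ≤ _ := by gcongr; exact l2_le_locD hl hG'

lemma boundedEval_of_cap_pos {μ : Measure ℂ} [IsFiniteMeasure μ] (hμ : OnCircle μ) {ζ : ℂ}
    (hζ : ‖ζ‖ = 1) (h : 0 < cap μ {ζ}) : BoundedEval μ ζ := by
  by_contra hcon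
  refine h.ne' (le_bot_iff.1 (le_of_forall_gt fun c hc => ?_))
  obtain ⟨c', hc'0, hc'⟩ := exists_between hc
  obtain ⟨q, hq1, hq⟩ := exists_normalized_of_not_boundedEval hcon (ε := c' / 16)
    (ENNReal.div_pos hc'0.ne' (by simp)) (ENNReal.div_ne_top hc'.ne_top (by simp))
  set u : ℝ → ℝ := fun t => 2 * ‖q.eval (bpt t)‖ with hu
  have hbc := continuous_bpt
  have huc : Continuous u := by
    have := q.continuous.comp hbc
    exact continuous_const.mul this.norm
  have huL : MemLp u 2 θm := by
    have := (memLp_of_continuous (Complex.continuous_ofReal.comp huc)).norm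
    simpa [Function.comp_def, hu] using this
  have hloc : ∫⁻ l, locD l (harmCoef u) ∂μ ≤ 16 * ∫⁻ l, locD l q.coeff ∂μ := by
    rw [← lintegral_const_mul _ (measurable_locD _)]
    refine lintegral_mono_ae ?_
    filter_upwards [ae_norm_eq_one hμ] with l hl
    exact locD_harmCoef_le q hl
  have hE : dEnergy μ (fun z => q.eval z) = coefNormSq μ q.coeff := dEnergy_polynomial μ q
  have hfin : ∫⁻ l, locD l (harmCoef u) ∂μ ≠ ⊤ := by
    refine ne_top_of_le_ne_top ?_ hloc
    have := coefNormSq_polynomial_ne_top hμ q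
    rw [coefNormSq, ENNReal.add_ne_top] at this
    exact ENNReal.mul_ne_top (by simp) this.2
  have hsq : ENNReal.ofReal ((1 / (2 * Real.pi)) * ∫ t in (0:ℝ)..(2 * Real.pi), (u t) ^ 2) =
      4 * l2 q.coeff := by
    simp only [hu, mul_pow]
    rw [intervalIntegral.integral_const_mul, mul_left_comm, ENNReal.ofReal_mul (by norm_num),
      l2_coeff_eq]
    norm_num
  have hnorm : ENNReal.ofReal (dhNormSq μ u) ≤ 16 * dEnergy μ (fun z => q.eval z) := by
    rw [ofReal_dhNormSq hμ huL hfin, hE, hsq, coefNormSq, mul_add]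
    gcongr
    norm_num
  refine lt_of_le_of_lt (le_trans ?_ hnorm) (lt_of_le_of_lt (b := c') ?_ hc')
  · refine iInf₂_le_of_le ({z | 1 / 2 < ‖q.eval z‖} ∩ circleT)
      ⟨⟨_, isOpen_lt continuous_const q.continuous.norm, rfl⟩, ?_⟩ ?_
    · rw [Set.singleton_subset_iff]
      refine ⟨?_, mem_circleT.2 hζ⟩
      simp only [mem_ofPred_eq, hq1]
      norm_num
    · refine iInf₂_le u ⟨(memDh_iff hμ huL).2 hfin, fun t => by positivity,
        Eventually.of_forall fun t ht => ?_⟩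
      have : 1 / 2 < ‖q.eval (bpt t)‖ := ht.1
      simp only [hu]; linarith
  · calc _ ≤ 16 * (c' / 16) := by gcongr
      _ = c' := ENNReal.mul_div_cancel (by simp) (by simp)

/-- `f` belongs to the closure of the polynomial multiples of `P` in `D(μ)`. -/
def InSpan (μ : Measure ℂ) (P : Polynomial ℂ) (f : ℂ → ℂ) : Prop :=
  DifferentiableOn ℂ f disc ∧ dEnergy μ f ≠ ⊤ ∧ ∀ ε : ℝ≥0∞, 0 < ε → ∃ q : Polynomial ℂ,
    dEnergy μ (fun z => f z - q.eval z * P.eval z) ≤ ε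

lemma differentiableOn_sub_mul_eval {f : ℂ → ℂ} (hf : DifferentiableOn ℂ f disc)
    (q P : Polynomial ℂ) : DifferentiableOn ℂ (fun z => f z - q.eval z * P.eval z) disc :=
  hf.sub ((differentiableOn_eval q).mul (differentiableOn_eval P))

lemma mem_closedSpan_iff {μ : Measure ℂ} [IsFiniteMeasure μ] (hμ : OnCircle μ) {P : Polynomial ℂ}
    {f : ℂ → ℂ} : f ∈ closedSpan μ (fun z => P.eval z) ↔ InSpan μ P f := by
  have hfin : ∀ q : Polynomial ℂ, DifferentiableOn ℂ f disc → dEnergy μ f ≠ ⊤ →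
      dEnergy μ (fun z => f z - q.eval z * P.eval z) ≠ ⊤ := fun q hf h => by
    have h1 := dEnergy_sub_le μ hf (differentiableOn_eval (q * P))
    simp only [Polynomial.eval_mul] at h1
    refine ne_top_of_le_ne_top ?_ h1
    have h2 := coefNormSq_polynomial_ne_top hμ (q * P)
    rw [← dEnergy_polynomial] at h2
    simp only [Polynomial.eval_mul] at h2
    finiteness
  rw [closedSpan, mem_ofPred_eq, memD_iff hμ, InSpan, and_assoc]
  refine and_congr_right fun hf => and_congr_right fun h => ⟨fun H ε hε => ?_, fun H ε hε => ?_⟩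
  · obtain ⟨x, -, hx, hxε⟩ := ENNReal.lt_iff_exists_real_btwn.1 hε
    obtain ⟨q, hq⟩ := H x (ENNReal.ofReal_pos.1 hx)
    refine ⟨q, ?_⟩
    rw [← ofReal_dNormSq hμ (differentiableOn_sub_mul_eval hf q P) (hfin q hf h)]
    exact (ENNReal.ofReal_le_ofReal hq.le).trans hxε.le
  · obtain ⟨q, hq⟩ := H (ENNReal.ofReal (ε / 2)) (by simpa using hε)
    refine ⟨q, ?_⟩
    rw [← ofReal_dNormSq hμ (differentiableOn_sub_mul_eval hf q P) (hfin q hf h),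
      ENNReal.ofReal_le_ofReal_iff (by positivity)] at hq
    linarith

/-- An element of `[(X - w) P]` is `z - w` times an element of `[P]` when `w` is in the disc. -/
lemma InSpan.exists_div {μ : Measure ℂ} (hμ : OnCircle μ) {P : Polynomial ℂ} {f : ℂ → ℂ} {w : ℂ}
    (hw : w ∈ disc) (h : InSpan μ ((Polynomial.X - Polynomial.C w) * P) f) :
    ∃ g, InSpan μ P g ∧ ∀ z ∈ disc, f z = (z - w) * g z := by
  obtain ⟨hf, hfin, h⟩ := h
  have hfw : f w = 0 := by
    set K := ENNReal.ofReal ((1 - ‖w‖ ^ 2)⁻¹)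
    have h1 : ∀ ε : ℝ≥0∞, 0 < ε → ENNReal.ofReal (‖f w‖ ^ 2) ≤ K * ε := fun ε hε => by
      obtain ⟨q, hq⟩ := h ε hε
      have := norm_sq_le_dEnergy μ (differentiableOn_sub_mul_eval hf q
          ((Polynomial.X - Polynomial.C w) * P)) hw
      simp only [Polynomial.eval_mul, Polynomial.eval_sub, Polynomial.eval_X, Polynomial.eval_C,
        sub_self, zero_mul, mul_zero, sub_zero] at this hq
      exact this.trans (by gcongr)
    have hlim : Tendsto (fun ε : ℝ≥0∞ => K * ε) (𝓝[>] 0) (𝓝 (K * 0)) :=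
      ENNReal.Tendsto.const_mul (tendsto_id.mono_left nhdsWithin_le_nhds)
        (Or.inr ENNReal.ofReal_ne_top)
    have h2 := ge_of_tendsto hlim (eventually_mem_nhdsWithin.mono fun ε hε => h1 ε hε)
    simpa using h2
  have hfz : ∀ z, f z = (z - w) * dslope f w z := fun z => by
    have := sub_smul_dslope f w z
    rw [hfw, sub_zero, smul_eq_mul] at this
    exact this.symm
  have hg : DifferentiableOn ℂ (dslope f w) disc :=
    (Complex.differentiableOn_dslope (isOpen_disc.mem_nhds hw)).2 hf
  set K := ENNReal.ofReal (((1 - ‖w‖)⁻¹) ^ 2)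
  have hK0 : K ≠ 0 := by
    have := mem_disc.1 hw
    have : 0 < 1 - ‖w‖ := by linarith
    simpa [K] using this.ne'
  have hK : K ≠ ⊤ := ENNReal.ofReal_ne_top
  refine ⟨dslope f w, ⟨hg, ?_, fun ε hε => ?_⟩, fun z _ => hfz z⟩
  · have h1 := dEnergy_div_le hμ hg hw
    simp only [← hfz] at h1
    exact ne_top_of_le_ne_top (ENNReal.mul_ne_top hK hfin) h1
  · obtain ⟨q, hq⟩ := h (ε / K) (ENNReal.div_pos hε.ne' hK)
    refine ⟨q, (dEnergy_div_le hμ (differentiableOn_sub_mul_eval hg q P) hw).trans ?_⟩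
    have h2 : (fun z => (z - w) * (dslope f w z - q.eval z * P.eval z)) = fun z => f z -
        q.eval z * ((Polynomial.X - Polynomial.C w) * P).eval z := by
      ext z
      rw [hfz z]
      simp only [Polynomial.eval_mul, Polynomial.eval_sub, Polynomial.eval_X, Polynomial.eval_C]
      ring
    rw [h2]
    exact (mul_le_mul_right hq K).trans ENNReal.mul_div_le

/-- The monic polynomial with root multiset `s`. -/
def rootProd (s : Multiset ℂ) : Polynomial ℂ :=
  (s.map fun w => Polynomial.X - Polynomial.C w).prod

lemma rootProd_cons (w : ℂ) (s : Multiset ℂ) :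
    rootProd (w ::ₘ s) = (Polynomial.X - Polynomial.C w) * rootProd s := by simp [rootProd]

lemma eval_rootProd_cons (w : ℂ) (s : Multiset ℂ) (z : ℂ) :
    (rootProd (w ::ₘ s)).eval z = (z - w) * (rootProd s).eval z := by simp [rootProd_cons]

lemma InSpan.exists_rootProd_div {μ : Measure ℂ} (hμ : OnCircle μ) {P : Polynomial ℂ}
    {s : Multiset ℂ} (hs : ∀ w ∈ s, w ∈ disc) {f : ℂ → ℂ} (h : InSpan μ (rootProd s * P) f) :
    ∃ g, InSpan μ P g ∧ ∀ z ∈ disc, f z = (rootProd s).eval z * g z := by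
  induction s using Multiset.induction_on generalizing f with
  | empty => exact ⟨f, by simpa [rootProd] using h, fun z _ => by simp [rootProd]⟩
  | cons w s ih =>
    rw [rootProd_cons, mul_assoc] at h
    obtain ⟨g, hg, hfg⟩ := h.exists_div hμ (hs w (Multiset.mem_cons_self w s))
    obtain ⟨k, hk, hgk⟩ := ih (fun v hv => hs v (Multiset.mem_cons_of_mem hv)) hg
    refine ⟨k, hk, fun z hz => ?_⟩
    rw [hfg z hz, hgk z hz, eval_rootProd_cons, mul_assoc]

lemma InSpan.hasRadialLimitAt {μ : Measure ℂ} {P : Polynomial ℂ} {f : ℂ → ℂ} (h : InSpan μ P f)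
    {ζ : ℂ} (hζ : ‖ζ‖ = 1) (hb : BoundedEval μ ζ) (hP : P.eval ζ = 0) : HasRadialLimitAt f ζ 0 := by
  obtain ⟨hf, hfin, h⟩ := h
  obtain ⟨C, hC, hb⟩ := hb.radial hζ
  rw [HasRadialLimitAt, Metric.tendsto_nhds]
  intro ε hε
  have hε2 : 0 < (ε / 2) ^ 2 := by positivity
  obtain ⟨q, hq⟩ := h (ENNReal.ofReal ((ε / 2) ^ 2) / 2 / C)
    (ENNReal.div_pos (ENNReal.div_pos (by simpa using hε.ne') (by simp)).ne' hC)
  have hlim : Tendsto (fun r : ℝ => (q * P).eval ((r : ℂ) * ζ)) (𝓝[<] 1) (𝓝 0) := by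
    have hc : Continuous fun r : ℝ => (q * P).eval ((r : ℂ) * ζ) :=
      (q * P).continuous.comp (by fun_prop)
    have h1 := hc.tendsto 1
    simp only [Complex.ofReal_one, one_mul, Polynomial.eval_mul, hP, mul_zero] at h1
    simpa using h1.mono_left nhdsWithin_le_nhds
  have hev := Metric.tendsto_nhds.1 hlim (ε / 2) (by positivity)
  have hev2 : ∀ᶠ r : ℝ in 𝓝[<] 1, r ∈ Ioo 0 1 := Ioo_mem_nhdsLT zero_lt_one
  filter_upwards [hev, hev2] with r h1 h2
  rw [dist_zero_right] at h1 ⊢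
  have h3 := (hb _ (differentiableOn_sub_mul_eval hf q P) r h2.1 h2.2).trans
    ((mul_le_mul_right hq C).trans ENNReal.mul_div_le)
  have h4 : ENNReal.ofReal ((ε / 2) ^ 2) / 2 < ENNReal.ofReal ((ε / 2) ^ 2) :=
    ENNReal.half_lt_self (by simpa using hε.ne') ENNReal.ofReal_ne_top
  have h5 := (ENNReal.ofReal_lt_ofReal_iff hε2).1 (h3.trans_lt h4)
  have h6 := lt_of_pow_lt_pow_left₀ 2 (by positivity) h5
  have h7 := norm_add_le (f (r * ζ) - q.eval (r * ζ) * P.eval (r * ζ)) ((q * P).eval (r * ζ))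
  rw [Polynomial.eval_mul, sub_add_cancel] at h7
  rw [Polynomial.eval_mul] at h1
  linarith

lemma dEnergy_ne_top_of_rootProd_mul {μ : Measure ℂ} (hμ : OnCircle μ) {s : Multiset ℂ}
    (hs : ∀ w ∈ s, w ∈ disc) {g : ℂ → ℂ} (hg : DifferentiableOn ℂ g disc)
    (h : dEnergy μ (fun z => (rootProd s).eval z * g z) ≠ ⊤) : dEnergy μ g ≠ ⊤ := by
  induction s using Multiset.induction_on with
  | empty => simpa [rootProd] using h
  | cons w s ih =>
    refine ih (fun v hv => hs v (Multiset.mem_cons_of_mem hv)) ?_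
    have h1 := dEnergy_div_le hμ ((differentiableOn_eval (rootProd s)).mul hg)
      (hs w (Multiset.mem_cons_self w s))
    simp only [eval_rootProd_cons, mul_assoc] at h
    exact ne_top_of_le_ne_top (ENNReal.mul_ne_top ENNReal.ofReal_ne_top h) h1

lemma inSpan_of_eq_mul {μ : Measure ℂ} [IsFiniteMeasure μ] (hμ : OnCircle μ) {P : Polynomial ℂ}
    {f g : ℂ → ℂ} (hf : DifferentiableOn ℂ f disc) (hfin : dEnergy μ f ≠ ⊤)
    (hg : DifferentiableOn ℂ g disc) (hgfin : dEnergy μ g ≠ ⊤)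
    (h : ∀ z ∈ disc, f z = P.eval z * g z) : InSpan μ P f := by
  obtain ⟨C, hC, hP⟩ := exists_dEnergy_eval_mul_le hμ P
  refine ⟨hf, hfin, fun ε hε => ?_⟩
  obtain ⟨q, hq⟩ := exists_polynomial_dEnergy_lt hg hgfin (ENNReal.div_pos hε.ne' hC)
  refine ⟨q, ?_⟩
  rw [dEnergy_congr μ (differentiableOn_sub_mul_eval hf q P)
    (g := fun z => P.eval z * (g z - q.eval z)) fun z hz => by rw [h z hz]; ring]
  exact (hP _ (hg.sub (differentiableOn_eval q))).trans
    ((mul_le_mul_right hq.le C).trans ENNReal.mul_div_le)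

lemma InSpan.C_mul {μ : Measure ℂ} {P : Polynomial ℂ} {f : ℂ → ℂ} (h : InSpan μ P f) {c : ℂ}
    (hc : c ≠ 0) : InSpan μ (Polynomial.C c * P) f := by
  refine ⟨h.1, h.2.1, fun ε hε => ?_⟩
  obtain ⟨q, hq⟩ := h.2.2 ε hε
  refine ⟨Polynomial.C c⁻¹ * q, ?_⟩
  convert hq using 4 with z
  simp only [Polynomial.eval_mul, Polynomial.eval_C]
  field_simp

/-- A factor `X - w` may be added if evaluation at `w` is unbounded on multiples of `P`. -/
lemma InSpan.X_sub_C_mul_of_approx {μ : Measure ℂ} {P : Polynomial ℂ} {f : ℂ → ℂ}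
    (h : InSpan μ P f) {w : ℂ} (hw : ∀ ε : ℝ≥0∞, 0 < ε → ∃ q : Polynomial ℂ, q.eval w = 1 ∧
      dEnergy μ (fun z => q.eval z * P.eval z) ≤ ε) :
    InSpan μ ((Polynomial.X - Polynomial.C w) * P) f := by
  obtain ⟨hf, hfin, h⟩ := h
  refine ⟨hf, hfin, fun ε hε => ?_⟩
  have hε4 : 0 < ε / 4 := ENNReal.div_pos hε.ne' (by simp)
  obtain ⟨k, hk⟩ := h (ε / 4) hε4
  obtain ⟨q, hq1, hq⟩ := hw (ε / 4 / ENNReal.ofReal (‖k.eval w‖ ^ 2))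
    (ENNReal.div_pos hε4.ne' ENNReal.ofReal_ne_top)
  have hroot : (k - Polynomial.C (k.eval w) * q).IsRoot w := by simp [hq1]
  obtain ⟨k', hk'⟩ := Polynomial.dvd_iff_isRoot.2 hroot
  refine ⟨k', ?_⟩
  have h1 : (fun z => f z - k'.eval z * ((Polynomial.X - Polynomial.C w) * P).eval z) = fun z =>
      (f z - k.eval z * P.eval z) + k.eval w * (q.eval z * P.eval z) := by
    ext z
    have := congrArg (Polynomial.eval z) hk'
    simp only [Polynomial.eval_mul, Polynomial.eval_sub, Polynomial.eval_X,
      Polynomial.eval_C] at this ⊢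
    linear_combination P.eval z * this
  have hd := (differentiableOn_eval q).mul (differentiableOn_eval P)
  have h2 := dEnergy_add_le μ (differentiableOn_sub_mul_eval hf k P) (hd.const_mul (k.eval w))
  rw [h1]
  refine h2.trans ?_
  rw [dEnergy_const_mul μ _ hd]
  calc _ ≤ 2 * (ε / 4) + 2 * (ε / 4) :=
        add_le_add (mul_le_mul_right hk 2)
          (mul_le_mul_right ((mul_le_mul_right hq _).trans ENNReal.mul_div_le) 2)
    _ = ε := by
        rw [← add_mul, show (2 : ℝ≥0∞) + 2 = 4 by norm_num,
          ENNReal.mul_div_cancel (by simp) (by simp)]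

lemma dEnergy_X_pow_le {μ : Measure ℂ} (hμ : OnCircle μ) (n : ℕ) :
    dEnergy μ (fun z => z ^ n) ≤ 1 + n * μ univ := by
  have h : HasCoef (fun z => z ^ n) (fun k => if k = n then (1 : ℂ) else 0) := fun z _ => by
    convert hasSum_ite_eq n (z ^ n) using 2 with k
    split_ifs with h <;> simp [h]
  rw [h.dEnergy_eq, coefNormSq]
  refine add_le_add ?_ ?_
  · rw [l2, tsum_eq_single n fun k hk => by simp [hk]]
    simp
  · calc _ ≤ ∫⁻ _, (n : ℝ≥0∞) ∂μ := by
          refine lintegral_mono_ae ((ae_norm_eq_one hμ).mono fun ζ hζ => ?_)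
          have h1 : (fun k => (if k + 1 = n then (1 : ℂ) else 0) * ζ ^ (k + 1)) = fun k =>
              (if k < n then ζ ^ n else 0) - (if k + 1 < n then ζ ^ n else 0) := by
            ext k
            rcases lt_trichotomy (k + 1) n with hk | hk | hk
            · simp [hk, hk.ne, (Nat.lt_succ_self k).trans hk]
            · simp [← hk]
            · simp [hk.ne', not_lt.2 (Nat.lt_succ_iff.1 hk), not_lt.2 hk.le]
          rw [locD, h1]
          refine (seqEnergy_diff_le fun k => if k < n then ζ ^ n else 0).trans ?_
          rw [l2, tsum_eq_sum (s := Finset.range n) fun k hk => by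
            simp [Finset.mem_range.not.1 hk]]
          refine (Finset.sum_le_card_nsmul _ _ 1 fun k hk => ?_).trans (by simp)
          simp [Finset.mem_range.1 hk, hζ]
      _ = _ := by simp

lemma not_boundedEval_of_one_lt {μ : Measure ℂ} [IsFiniteMeasure μ] (hμ : OnCircle μ) {w : ℂ}
    (hw : 1 < ‖w‖) : ¬BoundedEval μ w := by
  rintro ⟨C, hC, h⟩
  have h1 : ∀ n : ℕ, 1 ≤ C.toReal * (1 / (‖w‖ ^ 2) ^ n + (μ univ).toReal * (n / (‖w‖ ^ 2) ^ n)) :=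
      fun n => by
    have hX : dEnergy μ (fun z => (Polynomial.X ^ n : Polynomial ℂ).eval z) ≤ 1 + n * μ univ := by
      simpa only [Polynomial.eval_pow, Polynomial.eval_X] using dEnergy_X_pow_le hμ n
    have h2 := (h (Polynomial.X ^ n)).trans (mul_le_mul_right hX C)
    have hfin : C * (1 + n * μ univ) ≠ ⊤ := by finiteness
    rw [ENNReal.ofReal_le_iff_le_toReal hfin, ENNReal.toReal_mul, ENNReal.toReal_add (by simp)
      (by finiteness), ENNReal.toReal_mul] at h2
    simp only [Polynomial.eval_pow, Polynomial.eval_X, norm_pow, ENNReal.toReal_one,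
      ENNReal.toReal_natCast] at h2
    have hpos : 0 < (‖w‖ ^ 2) ^ n := by positivity
    rw [← mul_le_mul_iff_left₀ hpos, one_mul]
    calc _ = (‖w‖ ^ n) ^ 2 := by ring
      _ ≤ _ := h2
      _ = _ := by field_simp
  have hw2 : 1 < ‖w‖ ^ 2 := one_lt_pow₀ hw two_ne_zero
  have l1 := tendsto_pow_const_div_const_pow_of_one_lt 0 hw2
  have l2 := tendsto_pow_const_div_const_pow_of_one_lt 1 hw2
  simp only [pow_zero, pow_one] at l1 l2
  have := ge_of_tendsto ((l1.add (l2.const_mul (μ univ).toReal)).const_mul C.toReal)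
    (Eventually.of_forall h1)
  norm_num at this

/-- A factor vanishing at a point with unbounded evaluation may be added. -/
lemma InSpan.X_sub_C_mul_of_not_boundedEval {μ : Measure ℂ} [IsFiniteMeasure μ] (hμ : OnCircle μ)
    {P : Polynomial ℂ} {f : ℂ → ℂ} (h : InSpan μ P f) {w : ℂ} (hw : ¬BoundedEval μ w) :
    InSpan μ ((Polynomial.X - Polynomial.C w) * P) f := by
  obtain ⟨C, hC, hP⟩ := exists_dEnergy_eval_mul_le hμ P
  refine h.X_sub_C_mul_of_approx fun ε hε => ?_
  obtain ⟨q, hq1, hq⟩ := exists_normalized_of_not_boundedEval hw (ε := min (ε / C) 1)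
    (lt_min (ENNReal.div_pos hε.ne' hC) one_pos) (ne_top_of_le_ne_top (by simp) (min_le_right _ _))
  refine ⟨q, hq1, ?_⟩
  simp only [mul_comm (q.eval _)]
  exact (hP _ (differentiableOn_eval q)).trans
    ((mul_le_mul_right (hq.le.trans (min_le_left _ _)) C).trans ENNReal.mul_div_le)

/-- A simple zero may be added at a point of bounded evaluation where the radial limit is zero. -/
lemma InSpan.X_sub_C_mul_of_eval_ne_zero {μ : Measure ℂ} [IsFiniteMeasure μ] (hμ : OnCircle μ)
    {P : Polynomial ℂ} {f : ℂ → ℂ} (h : InSpan μ P f) {w : ℂ} (hw1 : ‖w‖ = 1)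
    (hw : BoundedEval μ w) (hPw : P.eval w ≠ 0) (hlim : HasRadialLimitAt f w 0) :
    InSpan μ ((Polynomial.X - Polynomial.C w) * P) f := by
  obtain ⟨hf, hfin, h⟩ := h
  obtain ⟨C, hC, hw⟩ := hw.radial hw1
  have hK : dEnergy μ (fun z => P.eval z) ≠ ⊤ := by
    rw [dEnergy_polynomial]; exact coefNormSq_polynomial_ne_top hμ P
  set K := dEnergy μ (fun z => P.eval z)
  set c := ENNReal.ofReal ((‖P.eval w‖ ^ 2)⁻¹)
  have hc : c ≠ ⊤ := ENNReal.ofReal_ne_top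
  refine ⟨hf, hfin, fun ε hε => ?_⟩
  obtain ⟨k, hk⟩ := h (ε / (2 + 2 * (C * c * K))) (ENNReal.div_pos hε.ne' (by finiteness))
  set δ := ε / (2 + 2 * (C * c * K))
  have hkP : ENNReal.ofReal (‖k.eval w * P.eval w‖ ^ 2) ≤ C * δ := by
    have hl : Tendsto (fun r : ℝ => k.eval ((r : ℂ) * w) * P.eval ((r : ℂ) * w)) (𝓝[<] 1)
        (𝓝 (k.eval w * P.eval w)) := by
      have hcont : Continuous fun r : ℝ => (k * P).eval ((r : ℂ) * w) :=
        (k * P).continuous.comp (by fun_prop)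
      simpa using (hcont.tendsto 1).mono_left (nhdsWithin_le_nhds (s := Iio 1))
    have hl2 := ENNReal.tendsto_ofReal ((Tendsto.sub hlim hl).norm.pow 2)
    rw [zero_sub, norm_neg] at hl2
    refine le_of_tendsto hl2 ?_
    filter_upwards [Ioo_mem_nhdsLT zero_lt_one] with r hr
    exact (hw _ (differentiableOn_sub_mul_eval hf k P) r hr.1 hr.2).trans (mul_le_mul_right hk C)
  have hkw : ENNReal.ofReal (‖k.eval w‖ ^ 2) ≤ C * c * δ := by
    calc _ = ENNReal.ofReal (‖k.eval w * P.eval w‖ ^ 2) * c := by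
          rw [← ENNReal.ofReal_mul (by positivity), norm_mul, mul_pow, mul_assoc,
            mul_inv_cancel₀ (by simpa using hPw), mul_one]
      _ ≤ C * δ * c := by gcongr
      _ = _ := by ring
  have hroot : (k - Polynomial.C (k.eval w)).IsRoot w := by simp
  obtain ⟨k', hk'⟩ := Polynomial.dvd_iff_isRoot.2 hroot
  refine ⟨k', ?_⟩
  have h1 : (fun z => f z - k'.eval z * ((Polynomial.X - Polynomial.C w) * P).eval z) = fun z =>
      (f z - k.eval z * P.eval z) + k.eval w * P.eval z := by
    ext z
    have := congrArg (Polynomial.eval z) hk'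
    simp only [Polynomial.eval_mul, Polynomial.eval_sub, Polynomial.eval_X,
      Polynomial.eval_C] at this ⊢
    linear_combination P.eval z * this
  rw [h1]
  refine (dEnergy_add_le μ (differentiableOn_sub_mul_eval hf k P)
    ((differentiableOn_eval P).const_mul (k.eval w))).trans ?_
  rw [dEnergy_const_mul μ _ (differentiableOn_eval P)]
  calc _ ≤ 2 * δ + 2 * (C * c * δ * K) := by gcongr
    _ = (2 + 2 * (C * c * K)) * δ := by ring
    _ ≤ ε := ENNReal.mul_div_le

/-- A zero on the circle may be repeated. -/
lemma InSpan.X_sub_C_mul_of_eval_eq_zero {μ : Measure ℂ} [IsFiniteMeasure μ] (hμ : OnCircle μ)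
    {P : Polynomial ℂ} {f : ℂ → ℂ} (h : InSpan μ P f) {w : ℂ} (hw1 : ‖w‖ = 1)
    (hPw : P.eval w = 0) : InSpan μ ((Polynomial.X - Polynomial.C w) * P) f := by
  obtain ⟨P₁, rfl⟩ := Polynomial.dvd_iff_isRoot.2 hPw
  obtain ⟨C, hC, hP⟩ := exists_dEnergy_eval_mul_le hμ P₁
  have hw0 : w ≠ 0 := norm_ne_zero_iff.1 (by rw [hw1]; exact one_ne_zero)
  have hD : ∀ n : ℕ, ∃ q : Polynomial ℂ, q.eval w = 1 ∧ ∀ z, (z - w) * q.eval z =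
      (w ^ n * (n + 1))⁻¹ * (z ^ (n + 1) - w ^ (n + 1) * 1) := fun n => by
    have hn : (n : ℂ) + 1 ≠ 0 := by exact_mod_cast n.succ_ne_zero
    refine ⟨Polynomial.C (w ^ n * (n + 1))⁻¹ * ∑ i ∈ Finset.range (n + 1),
      Polynomial.X ^ i * Polynomial.C (w ^ (n - i)), ?_, fun z => ?_⟩
    · simp only [Polynomial.eval_mul, Polynomial.eval_C, Polynomial.eval_finsetSum,
        Polynomial.eval_pow, Polynomial.eval_X]
      rw [Finset.sum_congr rfl (g := fun _ => w ^ n) fun i hi => by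
        rw [← pow_add, Nat.add_sub_cancel' (Nat.lt_succ_iff.1 (Finset.mem_range.1 hi))]]
      simp only [Finset.sum_const, Finset.card_range, nsmul_eq_mul, Nat.cast_add, Nat.cast_one]
      field_simp
    · simp only [Polynomial.eval_mul, Polynomial.eval_C, Polynomial.eval_finsetSum,
        Polynomial.eval_pow, Polynomial.eval_X]
      have := (Commute.all z w).geom_sum₂_mul (n + 1)
      simp only [Nat.add_sub_cancel] at this
      linear_combination (w ^ n * ((n : ℂ) + 1))⁻¹ * this
  have hbound : ∀ n : ℕ,
      dEnergy μ (fun z => (w ^ n * (n + 1))⁻¹ * (z ^ (n + 1) - w ^ (n + 1) * 1)) ≤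
      ENNReal.ofReal ((((n : ℝ) + 1) ^ 2)⁻¹ * (4 + 2 * (n + 1) * (μ univ).toReal)) := fun n => by
    have hx : DifferentiableOn ℂ (fun z : ℂ => z ^ (n + 1)) disc := by fun_prop
    have h1 : DifferentiableOn ℂ (fun _ : ℂ => w ^ (n + 1) * 1) disc := by fun_prop
    have hsub : DifferentiableOn ℂ (fun z : ℂ => z ^ (n + 1) - w ^ (n + 1) * 1) disc := hx.sub h1
    rw [dEnergy_const_mul μ _ hsub, ENNReal.ofReal_mul (by positivity)]
    have hnorm : ‖(w ^ n * ((n : ℂ) + 1))⁻¹‖ ^ 2 = (((n : ℝ) + 1) ^ 2)⁻¹ := by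
      rw [norm_inv, norm_mul, norm_pow, hw1, one_pow, one_mul, inv_pow]
      congr 2
      exact_mod_cast Complex.norm_natCast (n + 1)
    rw [hnorm]
    gcongr
    refine (dEnergy_sub_le μ hx h1).trans ?_
    rw [dEnergy_const_mul μ _ (differentiableOn_const 1), dEnergy_one, norm_pow, hw1]
    calc _ ≤ 2 * (1 + ((n + 1 : ℕ) : ℝ≥0∞) * μ univ) + 2 * 1 := by
          gcongr
          · exact dEnergy_X_pow_le hμ (n + 1)
          · simp
      _ = ENNReal.ofReal (4 + 2 * (n + 1) * (μ univ).toReal) := by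
          rw [ENNReal.ofReal_add (by positivity) (by positivity),
            ENNReal.ofReal_mul (by positivity), ENNReal.ofReal_toReal (measure_ne_top μ _),
            ENNReal.ofReal_mul (by positivity)]
          have : ENNReal.ofReal ((n : ℝ) + 1) = ((n + 1 : ℕ) : ℝ≥0∞) := by
            rw [← ENNReal.ofReal_natCast]; push_cast; rfl
          rw [this, ENNReal.ofReal_ofNat, ENNReal.ofReal_ofNat]
          ring
  have hlim : Tendsto (fun n : ℕ => C * ENNReal.ofReal
      ((((n : ℝ) + 1) ^ 2)⁻¹ * (4 + 2 * (n + 1) * (μ univ).toReal))) atTop (𝓝 0) := by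
    have l1 := tendsto_one_div_add_atTop_nhds_zero_nat (𝕜 := ℝ)
    have l2 := ((l1.pow 2).const_mul 4).add (l1.const_mul (2 * (μ univ).toReal))
    have l3 := ENNReal.Tendsto.const_mul (ENNReal.tendsto_ofReal l2) (Or.inr hC)
    simp only [zero_pow two_ne_zero, mul_zero, add_zero, ENNReal.ofReal_zero] at l3
    refine l3.congr fun n => ?_
    congr 2
    field_simp
  refine h.X_sub_C_mul_of_approx fun ε hε => ?_
  obtain ⟨n, hn⟩ := (hlim.eventually_lt_const hε).exists
  obtain ⟨q, hq1, hq⟩ := hD n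
  refine ⟨q, hq1, ?_⟩
  have h1 : (fun z => q.eval z * ((Polynomial.X - Polynomial.C w) * P₁).eval z) = fun z =>
      P₁.eval z * ((w ^ n * (n + 1))⁻¹ * (z ^ (n + 1) - w ^ (n + 1) * 1)) := by
    ext z
    simp only [Polynomial.eval_mul, Polynomial.eval_sub, Polynomial.eval_X, Polynomial.eval_C]
    linear_combination P₁.eval z * hq z
  rw [h1]
  exact (hP _ (by fun_prop)).trans ((mul_le_mul_right (hbound n) C).trans hn.le)

lemma InSpan.rootProd_mul {μ : Measure ℂ} [IsFiniteMeasure μ] (hμ : OnCircle μ)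
    {P : Polynomial ℂ} {f : ℂ → ℂ} (h : InSpan μ P f) {s : Multiset ℂ} (hs : ∀ w ∈ s, w ∉ disc)
    (hlim : ∀ w ∈ s, ‖w‖ = 1 → 0 < cap μ {w} → HasRadialLimitAt f w 0) :
    InSpan μ (rootProd s * P) f := by
  induction s using Multiset.induction_on with
  | empty => simpa [rootProd] using h
  | cons w s ih =>
    have ih := ih (fun v hv => hs v (Multiset.mem_cons_of_mem hv))
      (fun v hv => hlim v (Multiset.mem_cons_of_mem hv))
    rw [rootProd_cons, mul_assoc]
    by_cases hb : BoundedEval μ w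
    · have hw1 : ‖w‖ = 1 := by
        refine le_antisymm (not_lt.1 fun hw => not_boundedEval_of_one_lt hμ hw hb) ?_
        exact not_lt.1 fun hw => hs w (Multiset.mem_cons_self w s) (mem_disc.2 hw)
      by_cases hPw : (rootProd s * P).eval w = 0
      · exact ih.X_sub_C_mul_of_eval_eq_zero hμ hw1 hPw
      · exact ih.X_sub_C_mul_of_eval_ne_zero hμ hw1 hb hPw
          (hlim w (Multiset.mem_cons_self w s) hw1 (hb.cap_pos hμ hw1))
    · exact ih.X_sub_C_mul_of_not_boundedEval hμ hb

open scoped Classical in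
lemma eq_rootProd_mul_discPart (p : Polynomial ℂ) : p = Polynomial.C p.leadingCoeff *
    (rootProd (p.roots.filter fun w => w ∉ disc) * discPart p) := by
  conv_lhs => rw [(IsAlgClosed.splits p).eq_prod_roots]
  rw [discPart, rootProd, mul_comm (Multiset.prod _), ← Multiset.prod_add, ← Multiset.map_add,
    Multiset.filter_add_not]

/-- `[p]_{D(μ)} = {f ∈ D(μ) : f ∈ p_Λ H² and f has radial limit 0 at every
`ζ ∈ 𝕋` with `p(ζ) = 0` and `c_μ({ζ}) > 0`}`. -/
theorem closedSpan_polynomial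
    (μ : Measure ℂ) [IsFiniteMeasure μ] (hμ : OnCircle μ)
    (p : Polynomial ℂ) (hp : p ≠ 0) :
    closedSpan μ (fun z => p.eval z) =
      {f | MemD μ f ∧
        (∃ g, MemHardy2 g ∧ ∀ z ∈ disc, f z = (discPart p).eval z * g z) ∧
        ∀ ζ ∈ circleT, p.eval ζ = 0 → 0 < cap μ {ζ} → HasRadialLimitAt f ζ 0} := by
  classical
  have hp_eq := eq_rootProd_mul_discPart p
  set s := p.roots.filter fun w => w ∉ disc with hs
  have hdisc : discPart p = rootProd (p.roots.filter fun w => w ∈ disc) := rfl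
  have hin : ∀ w ∈ p.roots.filter fun w => w ∈ disc, w ∈ disc := fun w hw =>
    (Multiset.mem_filter.1 hw).2
  have hout : ∀ w ∈ s, w ∉ disc := fun w hw => (Multiset.mem_filter.1 hw).2
  ext f
  rw [mem_closedSpan_iff hμ, mem_ofPred_eq]
  refine ⟨fun h => ⟨(memD_iff hμ).2 ⟨h.1, h.2.1⟩, ?_, fun ζ hζ hpζ hcap => ?_⟩, ?_⟩
  · have h1 := h
    rw [hp_eq, ← mul_assoc, mul_comm, hdisc] at h1
    obtain ⟨g, hg, hfg⟩ := h1.exists_rootProd_div hμ hin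
    exact ⟨g, ((memD_iff hμ).2 ⟨hg.1, hg.2.1⟩).memHardy2, hfg⟩
  · have hζ1 := mem_circleT.1 hζ
    exact h.hasRadialLimitAt hζ1 (boundedEval_of_cap_pos hμ hζ1 hcap) hpζ
  · rintro ⟨hf, ⟨g, hg, hfg⟩, hlim⟩
    obtain ⟨hfd, hfin⟩ := (memD_iff hμ).1 hf
    have hgfin : dEnergy μ g ≠ ⊤ := by
      refine dEnergy_ne_top_of_rootProd_mul hμ hin hg.1 ?_
      rwa [dEnergy_congr μ hfd hfg] at hfin
    rw [hp_eq]
    refine ((inSpan_of_eq_mul hμ hfd hfin hg.1 hgfin hfg).rootProd_mul hμ hout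
      fun w hw hw1 hcap => ?_).C_mul (Polynomial.leadingCoeff_ne_zero.2 hp)
    exact hlim w (mem_circleT.2 hw1)
      (Polynomial.isRoot_of_mem_roots (Multiset.mem_filter.1 hw).1) hcap

end DirichletMu
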